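/- Let G be a Jordan domain, z₀ ∈ G, let φ be the normalized conformal map of G with respect to z₀, and for each n ≥ 1 let B_n be a Bieberbach polynomial of G with respect to z₀. Then for every z ∈ G one has B_n'(z) → φ'(z) and B_n(z) → φ(z) as n → ∞. -/

import Mathlib

open MeasureTheory Filter

/-- A Jordan domain: a bounded simply connected open subset of `ℂ` whose
boundary is a Jordan curve (the image of an injective continuous map of the
unit circle). -/
def IsJordanDomain (G : Set ℂ) : Prop :=
  IsOpen G ∧ Bornology.IsBounded G ∧ SimplyConnectedSpace G ∧
    ∃ γ : C(Metric.sphere (0 : ℂ) 1, ℂ),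
      Function.Injective γ ∧ Set.range γ = frontier G

/-- `B` is an `n`-th Bieberbach polynomial of `G` with respect to `z₀`:
`deg B ≤ n`, `B(z₀) = 0`, `B'(z₀) = 1`, and `B` minimizes `∫∫_G |P'|²` among
all polynomials `P` of degree at most `n` with `P(z₀) = 0`, `P'(z₀) = 1`. -/
def IsBieberbachPoly (G : Set ℂ) (z₀ : ℂ) (n : ℕ) (B : Polynomial ℂ) : Prop :=
  B.natDegree ≤ n ∧ B.eval z₀ = 0 ∧ B.derivative.eval z₀ = 1 ∧
  ∀ P : Polynomial ℂ, P.natDegree ≤ n → P.eval z₀ = 0 → P.derivative.eval z₀ = 1 →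
    (∫ z in G, ‖B.derivative.eval z‖ ^ 2) ≤ ∫ z in G, ‖P.derivative.eval z‖ ^ 2

section InverseFunction
open Set Topology Metric

theorem nhds_le_map_nhds_of_injOn {f : ℂ → ℂ} {s : Set ℂ} (hs : IsOpen s)
    (hf : DifferentiableOn ℂ f s) (hinj : InjOn f s) {x : ℂ} (hx : x ∈ s) :
    𝓝 (f x) ≤ map f (𝓝 x) := by
  refine ((hf.analyticAt (hs.mem_nhds hx)).eventually_constant_or_nhds_le_map_nhds).resolve_left ?_
  intro h
  have h2 : ∀ᶠ z in 𝓝 x, z = x := by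
    filter_upwards [h, hs.mem_nhds hx] with z hz hzs using hinj hzs hx hz
  have h3 : ∀ᶠ z in 𝓝[≠] x, False := by
    filter_upwards [h2.filter_mono nhdsWithin_le_nhds, self_mem_nhdsWithin] with z h1 h2 using h2 h1
  simp at h3
  exact (NormedField.nhdsNE_neBot x).ne h3

theorem isOpen_image_of_injOn {f : ℂ → ℂ} {s : Set ℂ} (hs : IsOpen s)
    (hf : DifferentiableOn ℂ f s) (hinj : InjOn f s) : IsOpen (f '' s) := by
  rw [isOpen_iff_mem_nhds]
  rintro _ ⟨x, hx, rfl⟩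
  exact nhds_le_map_nhds_of_injOn hs hf hinj hx (image_mem_map (hs.mem_nhds hx))

theorem continuousAt_invFunOn {f : ℂ → ℂ} {s : Set ℂ} (hs : IsOpen s)
    (hf : DifferentiableOn ℂ f s) (hinj : InjOn f s) {x : ℂ} (hx : x ∈ s) :
    ContinuousAt (Function.invFunOn f s) (f x) := by
  have hl := hinj.leftInvOn_invFunOn
  rw [ContinuousAt, hl hx]
  refine (map_mono (nhds_le_map_nhds_of_injOn hs hf hinj hx)).trans ?_
  rw [Filter.map_map]
  refine (tendsto_id.congr' ?_ : Tendsto _ (𝓝 x) (𝓝 x))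
  filter_upwards [hs.mem_nhds hx] with z hz using (hl hz).symm

theorem differentiableAt_invFunOn {f : ℂ → ℂ} {s : Set ℂ} (hs : IsOpen s)
    (hf : DifferentiableOn ℂ f s) (hinj : InjOn f s) {x : ℂ} (hx : x ∈ s) :
    DifferentiableAt ℂ (Function.invFunOn f s) (f x) := by
  have hl := hinj.leftInvOn_invFunOn
  have han := (hf.analyticAt (hs.mem_nhds hx)).deriv
  have hne : ∀ᶠ z in 𝓝[≠] x, deriv f z ≠ 0 := by
    refine han.eventually_eq_zero_or_eventually_ne_zero.resolve_left ?_
    intro h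
    obtain ⟨r, hr, hb⟩ := Metric.mem_nhds_iff.1 (h.and (hs.mem_nhds hx))
    have hc : ∀ z ∈ ball x r, f z = f x := by
      intro z hz
      refine (convex_ball x r).is_const_of_fderivWithin_eq_zero (𝕜 := ℂ)
        (hf.mono fun y hy => (hb hy).2) ?_ hz (mem_ball_self hr)
      intro y hy
      rw [fderivWithin_of_isOpen isOpen_ball hy]
      ext
      simpa using (hb hy).1
    have h3 : ∀ᶠ z in 𝓝[≠] x, False := by
      filter_upwards [nhdsWithin_le_nhds (ball_mem_nhds x hr), self_mem_nhdsWithin] with z h1 h2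
      exact h2 (hinj (hb h1).2 hx (hc z h1))
    simp at h3
    exact (NormedField.nhdsNE_neBot x).ne h3
  have hnb : ∀ᶠ z in 𝓝 x, z ≠ x → deriv f z ≠ 0 := eventually_nhdsWithin_iff.1 hne
  obtain ⟨r, hr, hb⟩ := Metric.mem_nhds_iff.1 (hnb.and (hs.mem_nhds hx))
  have hbs : ball x r ⊆ s := fun y hy => (hb hy).2
  have hopen := isOpen_image_of_injOn isOpen_ball (hf.mono hbs) (hinj.mono hbs)
  have hmem : f '' ball x r ∈ 𝓝 (f x) := hopen.mem_nhds ⟨x, mem_ball_self hr, rfl⟩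
  refine ((Complex.differentiableOn_compl_singleton_and_continuousAt_iff hmem).1 ⟨?_, ?_⟩
    ).differentiableAt hmem
  · rintro _ ⟨⟨y, hy, rfl⟩, hyx⟩
    have hyne : y ≠ x := fun h => hyx (by simp [h])
    refine (HasDerivAt.of_local_left_inverse (f := f) (f' := deriv f y)
      (continuousAt_invFunOn hs hf hinj (hbs hy)) ?_ ((hb hy).1 hyne) ?_
      ).differentiableAt.differentiableWithinAt
    · rw [hl (hbs hy)]
      exact (hf.differentiableAt (hs.mem_nhds (hbs hy))).hasDerivAt
    · filter_upwards [hopen.mem_nhds ⟨y, hy, rfl⟩]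
      rintro _ ⟨z, hz, rfl⟩
      rw [hl (hbs hz)]
  · exact continuousAt_invFunOn hs hf hinj hx

theorem deriv_ne_zero_of_injOn {f : ℂ → ℂ} {s : Set ℂ} (hs : IsOpen s)
    (hf : DifferentiableOn ℂ f s) (hinj : InjOn f s) {x : ℂ} (hx : x ∈ s) :
    deriv f x ≠ 0 := by
  have hl := hinj.leftInvOn_invFunOn
  have h1 := (differentiableAt_invFunOn hs hf hinj hx).hasDerivAt.comp x
    (hf.differentiableAt (hs.mem_nhds hx)).hasDerivAt
  have h2 : HasDerivAt (Function.invFunOn f s ∘ f) 1 x := by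
    refine (hasDerivAt_id x).congr_of_eventuallyEq ?_
    filter_upwards [hs.mem_nhds hx] with z hz using hl hz
  intro h0
  rw [h0, mul_zero] at h1
  exact one_ne_zero (h2.unique h1)

theorem hasDerivAt_invFunOn {f : ℂ → ℂ} {s : Set ℂ} (hs : IsOpen s)
    (hf : DifferentiableOn ℂ f s) (hinj : InjOn f s) {x : ℂ} (hx : x ∈ s) :
    HasDerivAt (Function.invFunOn f s) (deriv f x)⁻¹ (f x) := by
  have hl := hinj.leftInvOn_invFunOn
  refine HasDerivAt.of_local_left_inverse (f := f) (continuousAt_invFunOn hs hf hinj hx) ?_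
    (deriv_ne_zero_of_injOn hs hf hinj hx) ?_
  · rw [hl hx]
    exact (hf.differentiableAt (hs.mem_nhds hx)).hasDerivAt
  · filter_upwards [(isOpen_image_of_injOn hs hf hinj).mem_nhds ⟨x, hx, rfl⟩]
    rintro _ ⟨z, hz, rfl⟩
    rw [hl hz]

end InverseFunction

section Area
open Set Topology Metric

theorem Complex.det_restrictScalars_toSpanSingleton (a : ℂ) :
    ((ContinuousLinearMap.toSpanSingleton ℂ a).restrictScalars ℝ).det = ‖a‖ ^ 2 := by
  change LinearMap.det (((ContinuousLinearMap.toSpanSingleton ℂ a : ℂ →L[ℂ] ℂ) :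
    ℂ →ₗ[ℂ] ℂ).restrictScalars ℝ) = _
  rw [LinearMap.det_restrictScalars]
  change Algebra.norm ℝ (ContinuousLinearMap.toSpanSingleton ℂ a).det = _
  rw [ContinuousLinearMap.det_toSpanSingleton, Algebra.norm_complex_apply, Complex.normSq_eq_norm_sq]

theorem hasFDerivWithinAt_real {f : ℂ → ℂ} {s : Set ℂ} (hs : IsOpen s)
    (hf : DifferentiableOn ℂ f s) : ∀ x ∈ s, HasFDerivWithinAt f
      ((ContinuousLinearMap.toSpanSingleton ℂ (deriv f x)).restrictScalars ℝ) s x :=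
  fun _ hx => ((hf.differentiableAt (hs.mem_nhds hx)).hasDerivAt.hasFDerivAt.restrictScalars
    ℝ).hasFDerivWithinAt

theorem setIntegral_image_eq_of_injOn {f : ℂ → ℂ} {s : Set ℂ} (hs : IsOpen s)
    (hf : DifferentiableOn ℂ f s) (hinj : InjOn f s) (g : ℂ → ℂ) :
    ∫ w in f '' s, g w = ∫ z in s, ‖deriv f z‖ ^ 2 • g (f z) := by
  rw [integral_image_eq_integral_abs_det_fderiv_smul volume hs.measurableSet
    (hasFDerivWithinAt_real hs hf) hinj]
  simp_rw [Complex.det_restrictScalars_toSpanSingleton, abs_of_nonneg (sq_nonneg ‖_‖)]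

theorem integrableOn_image_iff_of_injOn {f : ℂ → ℂ} {s : Set ℂ} (hs : IsOpen s)
    (hf : DifferentiableOn ℂ f s) (hinj : InjOn f s) (g : ℂ → ℂ) :
    IntegrableOn g (f '' s) ↔ IntegrableOn (fun z => ‖deriv f z‖ ^ 2 • g (f z)) s := by
  rw [integrableOn_image_iff_integrableOn_abs_det_fderiv_smul volume hs.measurableSet
    (hasFDerivWithinAt_real hs hf) hinj]
  simp_rw [Complex.det_restrictScalars_toSpanSingleton, abs_of_nonneg (sq_nonneg ‖_‖)]

theorem lintegral_norm_deriv_sq_eq_volume_image {f : ℂ → ℂ} {s : Set ℂ} (hs : IsOpen s)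
    (hf : DifferentiableOn ℂ f s) (hinj : InjOn f s) :
    ∫⁻ z in s, ENNReal.ofReal (‖deriv f z‖ ^ 2) = volume (f '' s) := by
  rw [← lintegral_abs_det_fderiv_eq_addHaar_image volume hs.measurableSet
    (hasFDerivWithinAt_real hs hf) hinj]
  simp_rw [Complex.det_restrictScalars_toSpanSingleton, abs_of_nonneg (sq_nonneg ‖_‖)]

theorem integrableOn_norm_deriv_sq {f : ℂ → ℂ} {s : Set ℂ} (hs : IsOpen s)
    (hf : DifferentiableOn ℂ f s) (hinj : InjOn f s) (hfin : volume (f '' s) ≠ ⊤) :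
    IntegrableOn (fun z => ‖deriv f z‖ ^ 2) s := by
  refine ⟨?_, ?_⟩
  · exact ((hf.deriv hs).continuousOn.norm.pow 2).aestronglyMeasurable hs.measurableSet
  · rw [hasFiniteIntegral_iff_ofReal (ae_of_all _ fun z => by positivity),
      lintegral_norm_deriv_sq_eq_volume_image hs hf hinj]
    exact hfin.lt_top

theorem setIntegral_norm_deriv_sq {f : ℂ → ℂ} {s : Set ℂ} (hs : IsOpen s)
    (hf : DifferentiableOn ℂ f s) (hinj : InjOn f s) :
    ∫ z in s, ‖deriv f z‖ ^ 2 = volume.real (f '' s) := by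
  have hm : AEStronglyMeasurable (fun z => ‖deriv f z‖ ^ 2) (volume.restrict s) :=
    ((hf.deriv hs).continuousOn.norm.pow 2).aestronglyMeasurable hs.measurableSet
  rw [integral_eq_lintegral_of_nonneg_ae (ae_of_all _ fun z => by positivity) hm,
    lintegral_norm_deriv_sq_eq_volume_image hs hf hinj, Measure.real]

theorem setIntegral_ball_rotate (h : ℂ → ℂ) (c : ℂ) (r : ℝ) {a : ℂ} (ha : ‖a‖ = 1) :
    ∫ z in ball c r, h (c + a * (z - c)) = ∫ z in ball c r, h z := by
  have ha0 : a ≠ 0 := by rintro rfl; simp at ha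
  have hd : ∀ z, HasDerivAt (fun z => c + a * (z - c)) a z := fun z => by
    simpa using (((hasDerivAt_id z).sub_const c).const_mul a).const_add c
  have him : (fun z => c + a * (z - c)) '' ball c r = ball c r := by
    ext w
    constructor
    · rintro ⟨z, hz, rfl⟩
      simpa [dist_eq_norm, ha] using hz
    · intro hw
      refine ⟨c + a⁻¹ * (w - c), ?_, by field_simp; ring⟩
      simpa [dist_eq_norm, ha] using hw
  have := setIntegral_image_eq_of_injOn (f := fun z => c + a * (z - c)) (isOpen_ball (x := c) (ε := r))
    (fun z _ => (hd z).differentiableAt.differentiableWithinAt)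
    (fun x _ y _ hxy => by simpa [ha0] using hxy) h
  rw [him] at this
  rw [this]
  simp [(hd _).deriv, ha]

theorem setIntegral_ball_of_differentiableOn_closedBall {h : ℂ → ℂ} {c : ℂ} {r R : ℝ} (hr : 0 < r)
    (hrR : r < R) (hh : DifferentiableOn ℂ h (ball c R)) :
    ∫ z in ball c r, h z = (Real.pi * r ^ 2 : ℝ) * h c := by
  have hmaps : ∀ (θ : ℝ), ∀ z ∈ closedBall c r, c + circleMap 0 1 θ * (z - c) ∈ ball c R := by
    intro θ z hz
    rw [mem_closedBall, dist_eq_norm] at hz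
    simp only [mem_ball, dist_eq_norm, add_sub_cancel_left, norm_mul, norm_circleMap_zero, abs_one,
      one_mul]
    linarith
  have hint : IntegrableOn (fun p : ℝ × ℂ => h (c + circleMap 0 1 p.1 * (p.2 - c)))
      (Icc 0 (2 * Real.pi) ×ˢ closedBall c r) (volume.prod volume) := by
    refine ContinuousOn.integrableOn_compact (isCompact_Icc.prod (isCompact_closedBall c r)) ?_
    refine hh.continuousOn.comp (by fun_prop) ?_
    rintro ⟨θ, z⟩ ⟨-, hz⟩
    exact hmaps θ z hz
  have hint2 : Integrable (Function.uncurry fun (θ : ℝ) (z : ℂ) =>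
      h (c + circleMap 0 1 θ * (z - c)))
      ((volume.restrict (Ioc 0 (2 * Real.pi))).prod (volume.restrict (ball c r))) := by
    rw [Measure.prod_restrict]
    exact hint.mono_set (prod_mono Ioc_subset_Icc_self ball_subset_closedBall)
  have hswap := integral_integral_swap hint2
  have h1 : ∀ θ : ℝ, ∫ z in ball c r, h (c + circleMap 0 1 θ * (z - c)) = ∫ z in ball c r, h z :=
    fun θ => setIntegral_ball_rotate h c r (by simp)
  have h2 : ∀ z ∈ ball c r, ∫ θ in Ioc 0 (2 * Real.pi), h (c + circleMap 0 1 θ * (z - c))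
      = (2 * Real.pi : ℝ) • h c := by
    intro z hz
    have hk : DiffContOnCl ℂ (fun u => h (c + u * (z - c))) (ball 0 |1|) := by
      refine DifferentiableOn.diffContOnCl ?_
      rw [abs_one, closure_ball _ one_ne_zero]
      refine hh.comp (by fun_prop) ?_
      intro u hu
      rw [mem_closedBall_zero_iff] at hu
      rw [mem_ball, dist_eq_norm] at hz
      simp only [mem_ball, dist_eq_norm, add_sub_cancel_left, norm_mul]
      nlinarith [norm_nonneg (z - c)]
    have := hk.circleAverage
    rw [Real.circleAverage_def, intervalIntegral.integral_of_le (by positivity),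
      inv_smul_eq_iff₀ (by positivity)] at this
    simpa using this
  simp_rw [h1] at hswap
  rw [setIntegral_congr_fun measurableSet_ball h2, setIntegral_const, setIntegral_const,
    Measure.real, Measure.real, Complex.volume_ball, Real.volume_Ioc] at hswap
  simp only [sub_zero, ENNReal.toReal_mul, ENNReal.toReal_pow, ENNReal.toReal_ofReal hr.le,
    ENNReal.toReal_ofReal (by positivity : (0:ℝ) ≤ 2 * Real.pi), ENNReal.coe_toReal,
    NNReal.coe_real_pi, Complex.real_smul] at hswap
  have hpi : ((2 * Real.pi : ℝ) : ℂ) ≠ 0 := by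
    exact_mod_cast (by positivity : (2 * Real.pi : ℝ) ≠ 0)
  apply mul_left_cancel₀ hpi
  rw [hswap]
  push_cast
  ring

theorem setIntegral_ball_of_differentiableOn {h : ℂ → ℂ} {c : ℂ} {R : ℝ} (hR : 0 < R)
    (hh : DifferentiableOn ℂ h (ball c R)) (hint : IntegrableOn h (ball c R)) :
    ∫ z in ball c R, h z = (Real.pi * R ^ 2 : ℝ) * h c := by
  obtain ⟨u, hmono, hlt, hlim⟩ := exists_seq_strictMono_tendsto' hR
  have hU : ⋃ n, ball c (u n) = ball c R := by
    ext z
    simp only [mem_iUnion, mem_ball]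
    constructor
    · rintro ⟨n, hn⟩
      exact hn.trans (hlt n).2
    · intro hz
      exact (hlim.eventually (lt_mem_nhds hz)).exists
  have h1 := tendsto_setIntegral_of_monotone (μ := volume) (f := h) (s := fun n => ball c (u n))
    (fun n => measurableSet_ball) (fun m n hmn => ball_subset_ball (hmono.monotone hmn))
    (by rwa [hU])
  rw [hU] at h1
  have h2 : Tendsto (fun n => ((Real.pi * u n ^ 2 : ℝ) : ℂ) * h c) atTop
      (𝓝 (((Real.pi * R ^ 2 : ℝ) : ℂ) * h c)) := by
    refine Tendsto.mul_const _ ?_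
    exact (Complex.continuous_ofReal.tendsto _).comp ((hlim.pow 2).const_mul _)
  refine tendsto_nhds_unique h1 (h2.congr fun n => ?_)
  rw [setIntegral_ball_of_differentiableOn_closedBall (hlt n).1 (hlt n).2 hh]

end Area

section Approximation
open Set Topology Metric

/-- `f` is a uniform limit of polynomials on `V`. -/
def PolyApprox (V : Set ℂ) (f : ℂ → ℂ) : Prop :=
  ∀ ε > 0, ∃ p : Polynomial ℂ, ∀ z ∈ V, ‖f z - p.eval z‖ ≤ ε

namespace PolyApprox

variable {V W : Set ℂ} {f g : ℂ → ℂ}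

theorem mono (hf : PolyApprox V f) (h : W ⊆ V) : PolyApprox W f := fun ε hε ↦
  (hf ε hε).imp fun _ hp z hz ↦ hp z (h hz)

theorem congr (hf : PolyApprox V f) (h : EqOn g f V) : PolyApprox V g := fun ε hε ↦
  (hf ε hε).imp fun _ hp z hz ↦ by rw [h hz]; exact hp z hz

theorem polynomial (V : Set ℂ) (p : Polynomial ℂ) : PolyApprox V (fun z ↦ p.eval z) :=
  fun ε hε ↦ ⟨p, fun z _ ↦ by simpa using hε.le⟩

theorem const (V : Set ℂ) (c : ℂ) : PolyApprox V (fun _ ↦ c) := by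
  simpa using polynomial V (Polynomial.C c)

theorem sub_const (V : Set ℂ) (c : ℂ) : PolyApprox V (fun z ↦ z - c) :=
  (polynomial V (Polynomial.X - Polynomial.C c)).congr fun z _ ↦ by simp

theorem add (hf : PolyApprox V f) (hg : PolyApprox V g) :
    PolyApprox V (fun z ↦ f z + g z) := by
  intro ε hε
  obtain ⟨p, hp⟩ := hf (ε / 2) (by positivity)
  obtain ⟨q, hq⟩ := hg (ε / 2) (by positivity)
  refine ⟨p + q, fun z hz ↦ ?_⟩
  calc ‖f z + g z - (p + q).eval z‖ = ‖(f z - p.eval z) + (g z - q.eval z)‖ := by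
        rw [Polynomial.eval_add]; congr 1; ring
    _ ≤ ε := (norm_add_le _ _).trans (by linarith [hp z hz, hq z hz])

theorem const_mul (hf : PolyApprox V f) (c : ℂ) : PolyApprox V (fun z ↦ c * f z) := by
  intro ε hε
  obtain ⟨p, hp⟩ := hf (ε / (‖c‖ + 1)) (by positivity)
  refine ⟨Polynomial.C c * p, fun z hz ↦ ?_⟩
  rw [Polynomial.eval_mul, Polynomial.eval_C, ← mul_sub, norm_mul]
  have h1 := hp z hz
  rw [le_div_iff₀ (by positivity)] at h1
  nlinarith [norm_nonneg (f z - p.eval z)]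

theorem neg (hf : PolyApprox V f) : PolyApprox V (fun z ↦ -f z) := by
  simpa using hf.const_mul (-1)

theorem sub (hf : PolyApprox V f) (hg : PolyApprox V g) :
    PolyApprox V (fun z ↦ f z - g z) := by
  simpa [sub_eq_add_neg] using hf.add hg.neg

theorem exists_norm_le (hf : PolyApprox V f) (hV : Bornology.IsBounded V) :
    ∃ M > 0, ∀ z ∈ V, ‖f z‖ ≤ M := by
  obtain ⟨p, hp⟩ := hf 1 one_pos
  obtain ⟨C, hC⟩ := hV.isCompact_closure.exists_bound_of_continuousOn
    (f := fun z ↦ p.eval z) p.continuous.continuousOn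
  refine ⟨|C| + 1, by positivity, fun z hz ↦ ?_⟩
  have h1 := hp z hz
  have h2 := hC z (subset_closure hz)
  have h3 := norm_sub_norm_le (f z) (p.eval z)
  linarith [le_abs_self C]

theorem comp_of_differentiableOn {Φ : ℂ → ℂ} {c : ℂ} {r ρ : ℝ} (hr : r < ρ)
    (hΦ : DifferentiableOn ℂ Φ (ball c ρ)) (hf : PolyApprox V f)
    (hfV : ∀ z ∈ V, f z ∈ closedBall c r) : PolyApprox V (fun z ↦ Φ (f z)) := by
  intro ε hε
  rcases lt_or_ge r 0 with hr0 | hr0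
  · refine ⟨0, fun z hz ↦ ?_⟩
    have := hfV z hz
    rw [closedBall_eq_empty.2 hr0] at this
    exact this.elim
  obtain ⟨r', hr1, hr2⟩ := exists_between hr
  obtain ⟨R, hR1, hR2⟩ := exists_between hr2
  lift R to NNReal using by linarith
  lift r' to NNReal using by linarith
  have hps := (hΦ.mono (closedBall_subset_ball hR2)).hasFPowerSeriesOnBall (R := R)
    (by have : (r' : ℝ) ≥ 0 := r'.2
        exact_mod_cast (show (0:ℝ) < R by linarith))
  have hu := hps.tendstoUniformlyOn' (r' := r') (by exact_mod_cast hR1)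
  rw [Metric.tendstoUniformlyOn_iff] at hu
  obtain ⟨n, hn⟩ := (hu (ε / 2) (by positivity)).exists
  set P : Polynomial ℂ := ∑ k ∈ Finset.range n,
    Polynomial.C ((cauchyPowerSeries Φ c R).coeff k) * (Polynomial.X - Polynomial.C c) ^ k
  have hP : ∀ y, P.eval y = (cauchyPowerSeries Φ c R).partialSum n (y - c) := by
    intro y
    simp only [P, FormalMultilinearSeries.partialSum, Polynomial.eval_finsetSum,
      FormalMultilinearSeries.apply_eq_prod_smul_coeff]
    refine Finset.sum_congr rfl fun k _ ↦ ?_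
    simp [mul_comm]
  have hPu : UniformContinuousOn (fun y ↦ P.eval y) (closedBall c (r + (r' - r))) :=
    (isCompact_closedBall _ _).uniformContinuousOn_of_continuous P.continuous.continuousOn
  rw [Metric.uniformContinuousOn_iff] at hPu
  obtain ⟨δ, hδ, hPu⟩ := hPu (ε / 2) (by positivity)
  obtain ⟨q, hq⟩ := hf (min (δ / 2) (r' - r)) (lt_min (by positivity) (by linarith))
  refine ⟨P.comp q, fun z hz ↦ ?_⟩
  have hfz := hfV z hz
  rw [mem_closedBall] at hfz
  have hd : dist (f z) (q.eval z) ≤ min (δ / 2) (r' - r) := by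
    rw [dist_eq_norm]; exact hq z hz
  have h1 := hn (f z) (by rw [mem_ball]; linarith)
  have h2 := hPu (f z) (by rw [mem_closedBall]; linarith) (q.eval z)
    (by rw [mem_closedBall]
        have := dist_triangle (q.eval z) (f z) c
        rw [dist_comm (q.eval z) (f z)] at this
        linarith [min_le_right (δ / 2) (r' - r)])
    (by linarith [min_le_left (δ / 2) (r' - r)])
  rw [← hP] at h1
  rw [Polynomial.eval_comp, ← dist_eq_norm]
  linarith [dist_triangle (Φ (f z)) (P.eval (f z)) (P.eval (q.eval z))]

theorem comp_of_differentiable {Φ : ℂ → ℂ} (hΦ : Differentiable ℂ Φ) (hf : PolyApprox V f)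
    (hV : Bornology.IsBounded V) : PolyApprox V (fun z ↦ Φ (f z)) := by
  obtain ⟨M, -, hM⟩ := hf.exists_norm_le hV
  exact hf.comp_of_differentiableOn (c := 0) (lt_add_one M) hΦ.differentiableOn
    fun z hz ↦ by simpa using hM z hz

theorem mul (hf : PolyApprox V f) (hg : PolyApprox V g) (hV : Bornology.IsBounded V) :
    PolyApprox V (fun z ↦ f z * g z) := by
  have hsq : ∀ {h : ℂ → ℂ}, PolyApprox V h → PolyApprox V (fun z ↦ h z ^ 2) := fun hh ↦
    hh.comp_of_differentiable (Φ := fun z ↦ z ^ 2) (by fun_prop) hV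
  refine ((((hsq (hf.add hg)).sub (hsq hf)).sub (hsq hg)).const_mul (1 / 2)).congr fun z _ ↦ ?_
  ring

theorem differentiableOn (hf : PolyApprox V f) (hV : IsOpen V) : DifferentiableOn ℂ f V := by
  choose p hp using fun n : ℕ ↦ hf (1 / ((n : ℝ) + 1)) (by positivity)
  have hu : TendstoUniformlyOn (fun n z ↦ (p n).eval z) f atTop V := by
    rw [Metric.tendstoUniformlyOn_iff]
    intro ε hε
    filter_upwards [(tendsto_one_div_add_atTop_nhds_zero_nat (𝕜 := ℝ)).eventually
      (gt_mem_nhds hε)] with n hn z hz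
    rw [dist_eq_norm]
    exact (hp n z hz).trans_lt hn
  exact hu.tendstoLocallyUniformlyOn.differentiableOn
    (.of_forall fun n ↦ (p n).differentiable.differentiableOn) hV

end PolyApprox

/-- `F` has, near `K`, a logarithm which is a uniform limit of polynomials. -/
def HasPolyLog (K : Set ℂ) (F : ℂ → ℂ) : Prop :=
  ∃ V, IsOpen V ∧ K ⊆ V ∧ Bornology.IsBounded V ∧ ∃ Q, PolyApprox V Q ∧
    ∀ z ∈ V, Complex.exp (Q z) = F z

theorem HasPolyLog.mul {K : Set ℂ} {F G : ℂ → ℂ} (hF : HasPolyLog K F) (hG : HasPolyLog K G) :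
    HasPolyLog K (fun z ↦ F z * G z) := by
  obtain ⟨V, hV, hKV, hVb, Q, hQ, hQF⟩ := hF
  obtain ⟨W, hW, hKW, -, R, hR, hRG⟩ := hG
  refine ⟨V ∩ W, hV.inter hW, subset_inter hKV hKW, hVb.subset inter_subset_left,
    fun z ↦ Q z + R z, (hQ.mono inter_subset_left).add (hR.mono inter_subset_right),
    fun z hz ↦ ?_⟩
  rw [Complex.exp_add, hQF z hz.1, hRG z hz.2]

theorem IsCompact.exists_isOpen_isBounded_superset {K : Set ℂ} (hK : IsCompact K) :
    ∃ V, IsOpen V ∧ K ⊆ V ∧ Bornology.IsBounded V :=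
  ⟨thickening 1 K, isOpen_thickening, self_subset_thickening one_pos K, hK.isBounded.thickening⟩

theorem hasPolyLog_const {K : Set ℂ} (hK : IsCompact K) {c : ℂ} (hc : c ≠ 0) :
    HasPolyLog K (fun _ ↦ c) := by
  obtain ⟨V, hV, hKV, hVb⟩ := hK.exists_isOpen_isBounded_superset
  exact ⟨V, hV, hKV, hVb, _, PolyApprox.const V (Complex.log c), fun _ _ ↦ Complex.exp_log hc⟩

/-- Perturbing a function with a logarithm by a relative error of less than one half keeps a
logarithm. -/
theorem HasPolyLog.of_norm_sub_le {K W : Set ℂ} {F g : ℂ → ℂ} (hF : HasPolyLog K F)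
    (hW : IsOpen W) (hKW : K ⊆ W) (hFa : PolyApprox W F) (hga : PolyApprox W g)
    (h : ∀ z ∈ W, ‖F z - g z‖ ≤ ‖F z‖ / 2) : HasPolyLog K g := by
  obtain ⟨V, hV, hKV, hVb, Q, hQ, hQF⟩ := hF
  have hb : Bornology.IsBounded (V ∩ W) := hVb.subset inter_subset_left
  have hQ' : PolyApprox (V ∩ W) Q := hQ.mono inter_subset_left
  have hu : PolyApprox (V ∩ W) (fun z ↦ 1 - (F z - g z) * Complex.exp (-Q z)) :=
    (PolyApprox.const _ 1).sub <|
    ((hFa.sub hga).mono inter_subset_right).mul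
      (hQ'.neg.comp_of_differentiable Complex.differentiable_exp hb) hb
  have hub : ∀ z ∈ V ∩ W, 1 - (F z - g z) * Complex.exp (-Q z) ∈ closedBall (1 : ℂ) (1 / 2) := by
    intro z hz
    rw [mem_closedBall, dist_eq_norm, Complex.exp_neg, hQF z hz.1]
    have h0 : F z ≠ 0 := by rw [← hQF z hz.1]; exact Complex.exp_ne_zero _
    have := h z hz.2
    rw [sub_sub_cancel_left, norm_neg, norm_mul, norm_inv, mul_inv_le_iff₀ (norm_pos_iff.2 h0)]
    linarith
  have hlog : DifferentiableOn ℂ Complex.log (ball 1 1) := fun z hz ↦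
    (Complex.differentiableAt_log (Complex.ball_one_subset_slitPlane hz)).differentiableWithinAt
  refine ⟨V ∩ W, hV.inter hW, subset_inter hKV hKW, hb, _,
    hQ'.add (hu.comp_of_differentiableOn (by norm_num) hlog hub), fun z hz ↦ ?_⟩
  have hne : 1 - (F z - g z) * Complex.exp (-Q z) ≠ 0 := by
    intro h0
    have := hub z hz
    rw [h0] at this
    norm_num at this
  rw [Complex.exp_add, Complex.exp_log hne, mul_sub, mul_one, mul_left_comm, ← Complex.exp_add,
    hQF z hz.1]
  simp

/-- The polynomially convex hull. -/
def polyHull (X : Set ℂ) : Set ℂ := {w | ∀ p : Polynomial ℂ, ∃ z ∈ X, ‖p.eval w‖ ≤ ‖p.eval z‖}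

theorem subset_polyHull (X : Set ℂ) : X ⊆ polyHull X := fun w hw _ ↦ ⟨w, hw, le_rfl⟩

theorem exists_of_notMem_polyHull {X : Set ℂ} (hX : IsCompact X) (hne : X.Nonempty) {w : ℂ}
    (hw : w ∉ polyHull X) : ∃ p : Polynomial ℂ, ∃ C : ℝ, 0 ≤ C ∧ C < ‖p.eval w‖ ∧
      ∀ z ∈ polyHull X, ‖p.eval z‖ ≤ C := by
  simp only [polyHull, mem_ofPred_eq, not_forall, not_exists, not_and, not_le] at hw
  obtain ⟨p, hp⟩ := hw
  obtain ⟨x, hx, hmax⟩ := hX.exists_isMaxOn hne (f := fun z ↦ ‖p.eval z‖)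
    p.continuous.norm.continuousOn
  refine ⟨p, ‖p.eval x‖, norm_nonneg _, hp x hx, fun z hz ↦ ?_⟩
  obtain ⟨y, hy, h⟩ := hz p
  exact h.trans (hmax hy)

theorem isCompact_polyHull {X : Set ℂ} (hX : IsCompact X) (hne : X.Nonempty) :
    IsCompact (polyHull X) := by
  refine Metric.isCompact_of_isClosed_isBounded ?_ ?_
  · rw [← isOpen_compl_iff, isOpen_iff_mem_nhds]
    intro w hw
    obtain ⟨p, C, -, hpw, hp⟩ := exists_of_notMem_polyHull hX hne hw
    filter_upwards [p.continuous.norm.continuousAt.eventually (lt_mem_nhds hpw)] with v hv hvK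
    exact (hp v hvK).not_gt hv
  · obtain ⟨C, hC⟩ := hX.isBounded.exists_norm_le
    refine isBounded_iff_forall_norm_le.2 ⟨C, fun w hw ↦ ?_⟩
    obtain ⟨z, hz, h⟩ := hw Polynomial.X
    simp only [Polynomial.eval_X] at h
    exact h.trans (hC z hz)

theorem hasPolyLog_sub_of_dist_lt {K : Set ℂ} {w v : ℂ} {d : ℝ} (hv : ∀ z ∈ K, d ≤ dist z v)
    (hd : dist v w < d / 2) (h : HasPolyLog K (fun z ↦ z - v)) :
    HasPolyLog K (fun z ↦ z - w) := by
  refine h.of_norm_sub_le (W := {z | dist v w < dist z v / 2}) ?_ ?_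
    (PolyApprox.sub_const _ v) (PolyApprox.sub_const _ w) ?_
  · exact isOpen_lt (by fun_prop) (by fun_prop)
  · intro z hz
    have := hv z hz
    simp only [mem_ofPred_eq]
    linarith
  · intro z hz
    simp only [mem_ofPred_eq, dist_eq_norm] at hz
    rw [sub_sub_sub_cancel_left, norm_sub_rev]
    exact hz.le

theorem hasPolyLog_sub_of_notMem_polyHull {X : Set ℂ} (hX : IsCompact X) (hne : X.Nonempty)
    {w : ℂ} (hw : w ∉ polyHull X) : HasPolyLog (polyHull X) (fun z ↦ z - w) := by
  have hK := isCompact_polyHull hX hne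
  set K := polyHull X with hKdef
  have hKne : K.Nonempty := hne.mono (subset_polyHull X)
  set B : Set ℂ := {w | w ∉ K ∧ ¬ HasPolyLog K (fun z ↦ z - w)} with hB
  by_contra hcon
  have hwB : w ∈ B := ⟨hw, hcon⟩
  have hBb : Bornology.IsBounded B := by
    obtain ⟨C, hC⟩ := hK.isBounded.exists_norm_le
    have hC0 : 0 ≤ C := by
      obtain ⟨k, hk⟩ := hKne
      exact (norm_nonneg _).trans (hC k hk)
    refine isBounded_iff_forall_norm_le.2 ⟨2 * C + 2, fun v hv ↦ ?_⟩
    by_contra! hlt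
    refine hv.2 ?_
    have hv0 : -v ≠ 0 := by
      rw [neg_ne_zero, ← norm_pos_iff]; linarith
    refine (hasPolyLog_const hK hv0).of_norm_sub_le (W := ball 0 (C + 1)) isOpen_ball
      (fun z hz ↦ ?_) (PolyApprox.const _ _) (PolyApprox.sub_const _ v)
      (fun z hz ↦ ?_)
    · simpa using (hC z hz).trans_lt (lt_add_one C)
    · have : ‖z‖ < C + 1 := by simpa using hz
      rw [show -v - (z - v) = -z by ring, norm_neg, norm_neg]
      linarith
  have hfr : frontier B ⊆ K := by
    intro v hv
    by_contra hvK
    have hd : 0 < infDist v K := (hK.isClosed.notMem_iff_infDist_pos hKne).1 hvK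
    set d := infDist v K
    have hdK : ∀ z ∈ K, d ≤ dist v z := fun z hz ↦ infDist_le_dist_of_mem hz
    rw [frontier_eq_closure_inter_closure] at hv
    obtain ⟨a, ha, hva⟩ := Metric.mem_closure_iff.1 hv.1 (d / 8) (by positivity)
    obtain ⟨b, hb, hvb⟩ := Metric.mem_closure_iff.1 hv.2 (d / 8) (by positivity)
    have hbK : b ∉ K := fun h ↦ by linarith [hdK b h]
    have hbl : HasPolyLog K (fun z ↦ z - b) := by
      by_contra h
      exact hb ⟨hbK, h⟩
    refine ha.2 (hasPolyLog_sub_of_dist_lt (d := d / 2) (fun z hz ↦ ?_) ?_ hbl)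
    · have := hdK z hz
      linarith [dist_triangle v b z, dist_comm z b]
    · linarith [dist_triangle b v a, dist_comm b v]
  obtain ⟨p, C, -, hpw, hp⟩ := exists_of_notMem_polyHull hX hne hw
  exact (Complex.norm_le_of_forall_mem_frontier_norm_le hBb
    (p.differentiable.diffContOnCl) (fun z hz ↦ hp z (hfr hz)) (subset_closure hwB)).not_gt hpw

theorem hasPolyLog_polynomial {X : Set ℂ} (hX : IsCompact X) (hne : X.Nonempty)
    {p : Polynomial ℂ} (hp : ∀ z ∈ polyHull X, p.eval z ≠ 0) :
    HasPolyLog (polyHull X) (fun z ↦ p.eval z) := by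
  have hK := isCompact_polyHull hX hne
  have hp0 : p ≠ 0 := by
    rintro rfl
    obtain ⟨x, hx⟩ := hne
    exact hp x (subset_polyHull X hx) (by simp)
  have key : ∀ s : Multiset ℂ, (∀ a ∈ s, a ∉ polyHull X) →
      HasPolyLog (polyHull X) (fun z ↦ (s.map fun a ↦ z - a).prod) := by
    intro s
    induction s using Multiset.induction with
    | empty => intro _; simpa using hasPolyLog_const hK one_ne_zero
    | cons a s ih =>
      intro h
      simp only [Multiset.map_cons, Multiset.prod_cons]
      exact (hasPolyLog_sub_of_notMem_polyHull hX hne (h a (by simp))).mul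
        (ih fun b hb ↦ h b (by simp [hb]))
  have h1 := (hasPolyLog_const hK (Polynomial.leadingCoeff_ne_zero.2 hp0)).mul
    (key p.roots fun a ha haK ↦ hp a haK (Polynomial.isRoot_of_mem_roots ha))
  convert h1 using 2 with z
  conv_lhs => rw [(IsAlgClosed.splits p).eq_prod_roots]
  simp [Polynomial.eval_multiset_prod, Multiset.map_map]

/-- A non-vanishing uniform limit of polynomials near a polynomially convex compact set has a
logarithm which is a uniform limit of polynomials. -/
theorem PolyApprox.hasPolyLog {X V : Set ℂ} (hX : IsCompact X) (hne : X.Nonempty) {F : ℂ → ℂ}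
    (hV : IsOpen V) (hKV : polyHull X ⊆ V) (hF : PolyApprox V F)
    (h0 : ∀ z ∈ polyHull X, F z ≠ 0) : HasPolyLog (polyHull X) F := by
  have hK := isCompact_polyHull hX hne
  have hc : ContinuousOn F V := (hF.differentiableOn hV).continuousOn
  obtain ⟨x, hx, hmin⟩ := hK.exists_isMinOn (hne.mono (subset_polyHull X))
    (f := fun z ↦ ‖F z‖) (hc.norm.mono hKV)
  have hm : 0 < ‖F x‖ := norm_pos_iff.2 (h0 x hx)
  set m := ‖F x‖
  have hWo : IsOpen (V ∩ (fun z ↦ ‖F z‖) ⁻¹' Ioi (m / 2)) :=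
    hc.norm.isOpen_inter_preimage hV isOpen_Ioi
  have hKW : polyHull X ⊆ V ∩ (fun z ↦ ‖F z‖) ⁻¹' Ioi (m / 2) := fun z hz ↦
    ⟨hKV hz, (half_lt_self hm).trans_le (hmin hz)⟩
  obtain ⟨p, hp⟩ := hF (m / 8) (by positivity)
  have hbd : ∀ z ∈ V ∩ (fun z ↦ ‖F z‖) ⁻¹' Ioi (m / 2), 3 * m / 8 < ‖p.eval z‖ := by
    intro z hz
    have h1 : m / 2 < ‖F z‖ := hz.2
    linarith [hp z hz.1, norm_sub_norm_le (F z) (p.eval z)]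
  refine (hasPolyLog_polynomial hX hne (p := p) fun z hz h ↦ ?_).of_norm_sub_le hWo hKW
    (PolyApprox.polynomial _ p) (hF.mono inter_subset_left) fun z hz ↦ ?_
  · have := hbd z (hKW hz)
    rw [h, norm_zero] at this
    linarith
  · rw [norm_sub_rev]
    linarith [hp z hz.1, hbd z hz]

end Approximation

section JordanCurve
open Set Topology Metric

theorem frontier_polyHull_subset {X : Set ℂ} (hX : IsCompact X) (hne : X.Nonempty) :
    frontier (polyHull X) ⊆ X := by
  intro w hw
  by_contra hwX
  have hK := isCompact_polyHull hX hne
  have hwK : w ∈ polyHull X := hK.isClosed.frontier_subset hw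
  have hd : 0 < infDist w X := (hX.isClosed.notMem_iff_infDist_pos hne).1 hwX
  set d := infDist w X
  have hdX : ∀ z ∈ X, d ≤ dist w z := fun z hz ↦ infDist_le_dist_of_mem hz
  rw [frontier_eq_closure_inter_closure] at hw
  obtain ⟨v, hv, hwv⟩ := Metric.mem_closure_iff.1 hw.2 (d / 8) (by positivity)
  obtain ⟨p, C, hC0, hC, hpC⟩ := exists_of_notMem_polyHull hX hne hv
  have hpv : 0 < ‖p.eval v‖ := hC0.trans_lt hC
  obtain ⟨m, hm⟩ := exists_pow_lt_of_lt_one (show (0 : ℝ) < 1 / 4 by norm_num)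
    ((div_lt_one hpv).2 hC)
  set P : Polynomial ℂ := (Polynomial.C (p.eval v)⁻¹ * p) ^ m with hP
  have hPv : P.eval v = 1 := by
    simp [hP, inv_mul_cancel₀ (norm_pos_iff.1 hpv)]
  have hPX : ∀ z ∈ X, ‖P.eval z‖ ≤ 1 / 4 := by
    intro z hz
    refine le_trans ?_ hm.le
    simp only [hP, Polynomial.eval_pow, Polynomial.eval_mul, Polynomial.eval_C, norm_pow, norm_mul,
      norm_inv]
    rw [inv_mul_eq_div]
    gcongr
    exact hpC z (subset_polyHull X hz)
  obtain ⟨q, hq⟩ : Polynomial.X - Polynomial.C v ∣ 1 - P := by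
    rw [Polynomial.dvd_iff_isRoot]
    simp [hPv]
  have hq' : ∀ z, (z - v) * q.eval z = 1 - P.eval z := fun z ↦ by
    simpa using (congrArg (Polynomial.eval z) hq).symm
  obtain ⟨z, hz, hle⟩ := hwK (1 - (Polynomial.X - Polynomial.C w) * q)
  simp only [Polynomial.eval_sub, Polynomial.eval_one, Polynomial.eval_mul, Polynomial.eval_X,
    Polynomial.eval_C, sub_self, zero_mul, sub_zero, norm_one] at hle
  have h1 : 1 - (z - w) * q.eval z = P.eval z + (w - v) * q.eval z := by
    linear_combination -hq' z
  have h2 : ‖z - v‖ * ‖q.eval z‖ ≤ 5 / 4 := by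
    rw [← norm_mul, hq']
    refine (norm_sub_le _ _).trans ?_
    rw [norm_one]
    linarith [hPX z hz]
  have h3 : 7 * d / 8 ≤ ‖z - v‖ := by
    rw [← dist_eq_norm]
    linarith [hdX z hz, dist_triangle w v z, dist_comm v z]
  have h4 : ‖w - v‖ ≤ d / 8 := by rw [← dist_eq_norm]; exact hwv.le
  rw [h1] at hle
  have h5 := norm_add_le (P.eval z) ((w - v) * q.eval z)
  rw [norm_mul] at h5
  nlinarith [hPX z hz, norm_nonneg (q.eval z), mul_le_mul_of_nonneg_right h4 (norm_nonneg (q.eval z)),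
    mul_le_mul_of_nonneg_right h3 (norm_nonneg (q.eval z))]

theorem exists_continuous_exp_eq {E : Type*} [NormedAddCommGroup E] [NormedSpace ℝ E]
    {g : E → ℂ} (hg : Continuous g) (h0 : ∀ x, g x ≠ 0) :
    ∃ L : E → ℂ, Continuous L ∧ ∀ x, Complex.exp (L x) = g x := by
  have hu : IsSimplyConnected (univ : Set E) := by
    have := (convex_univ (𝕜 := ℝ) (E := E)).contractibleSpace univ_nonempty
    exact inferInstanceAs (SimplyConnectedSpace (univ : Set E))
  obtain ⟨f, hf, hfe⟩ := Complex.exists_continuousOn_eqOn_exp_comp hu isOpen_univ hg.continuousOn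
    (by rintro ⟨x, -, hx⟩; exact h0 x hx)
  exact ⟨f, continuousOn_univ.1 hf, fun x ↦ hfe (mem_univ x)⟩

/-- There is no continuous logarithm of a nonvanishing function which equals `z - z₀` near
infinity. -/
theorem exists_eq_zero_of_eq_sub {f : ℂ → ℂ} (hf : Continuous f) {z₀ : ℂ} {ρ : ℝ} (hρ : 0 < ρ)
    (h : ∀ z ∈ sphere z₀ ρ, f z = z - z₀) : ∃ z, f z = 0 := by
  by_contra! h0
  obtain ⟨L, hL, hLe⟩ := exists_continuous_exp_eq hf h0
  set D : ℝ → ℂ := fun θ ↦ L (circleMap z₀ ρ θ) - θ * Complex.I - Real.log ρ with hD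
  have hDc : Continuous D := by fun_prop
  have hDe : ∀ θ, ∃ n : ℤ, (D θ).im = n * (2 * Real.pi) := by
    intro θ
    have : Complex.exp (D θ) = 1 := by
      rw [hD]
      simp only
      rw [Complex.exp_sub, Complex.exp_sub, hLe, h _ (circleMap_mem_sphere z₀ hρ.le θ),
        circleMap_sub_center, circleMap_zero, ← Complex.ofReal_exp, Real.exp_log hρ]
      have : (ρ : ℂ) ≠ 0 := by exact_mod_cast hρ.ne'
      field_simp [Complex.exp_ne_zero]
    obtain ⟨n, hn⟩ := Complex.exp_eq_one_iff.1 this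
    refine ⟨n, ?_⟩
    rw [hn]
    simp
  have h2 : (D (2 * Real.pi)).im = (D 0).im - 2 * Real.pi := by
    have : circleMap z₀ ρ (2 * Real.pi) = circleMap z₀ ρ 0 := by
      simp [circleMap]
    simp [hD, this]
  obtain ⟨n, hn⟩ := hDe 0
  obtain ⟨θ, hθ⟩ := mem_range_of_exists_le_of_exists_ge (Complex.continuous_im.comp hDc)
    (c := n * (2 * Real.pi) - Real.pi)
    ⟨2 * Real.pi, by simp only [Function.comp]; linarith [Real.pi_pos]⟩
    ⟨0, by simp only [Function.comp]; linarith [Real.pi_pos]⟩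
  obtain ⟨k, hk⟩ := hDe θ
  simp only [Function.comp] at hθ
  have h3 : (2 * (k : ℝ) - 2 * n + 1) * Real.pi = 0 := by linear_combination hθ - hk
  have h4 : 2 * (k : ℝ) - 2 * n + 1 = 0 := (mul_eq_zero.1 h3).resolve_right Real.pi_ne_zero
  have h5 : 2 * k - 2 * n + 1 = 0 := by exact_mod_cast h4
  omega

/-- On a closed proper subset of a Jordan curve avoiding `z₀` the function `z - z₀` has a
continuous logarithm. -/
theorem exists_continuous_log_of_subset_range {γ : C(sphere (0 : ℂ) 1, ℂ)}
    (hγ : Function.Injective γ) {t₀ : sphere (0 : ℂ) 1} {F : Set ℂ} (hF : F ⊆ range γ)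
    (ht₀ : γ t₀ ∉ F) {z₀ : ℂ} (hz₀ : z₀ ∉ range γ) :
    ∃ ℓ : C(F, ℂ), ∀ z, Complex.exp (ℓ z) = z - z₀ := by
  have hemb := γ.continuous.isClosedEmbedding hγ
  set e := hemb.isEmbedding.toHomeomorph
  set t : F → sphere (0 : ℂ) 1 := fun z ↦ e.symm ⟨z, hF z.2⟩ with ht
  have htc : Continuous t := by fun_prop
  have hγt : ∀ z, γ (t z) = z := fun z ↦ congrArg Subtype.val (e.apply_symm_apply ⟨z, hF z.2⟩)
  have ht₀n : ‖(t₀ : ℂ)‖ = 1 := by simp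
  have ht₀0 : (t₀ : ℂ) ≠ 0 := norm_pos_iff.1 (by rw [ht₀n]; exact one_pos)
  have hcirc : ∀ θ : ℝ, -(t₀ : ℂ) * Complex.exp (θ * Complex.I) ∈ sphere (0 : ℂ) 1 := fun θ ↦ by
    simp [ht₀n, Complex.norm_exp_ofReal_mul_I]
  obtain ⟨L, hL, hLe⟩ := exists_continuous_exp_eq
    (g := fun θ : ℝ ↦ γ ⟨-(t₀ : ℂ) * Complex.exp (θ * Complex.I), hcirc θ⟩ - z₀)
    (by fun_prop) (fun θ h ↦ hz₀ ⟨_, sub_eq_zero.1 h⟩)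
  have hn : ∀ z, ‖-(t z : ℂ) / t₀‖ = 1 := fun z ↦ by
    have : ‖(t z : ℂ)‖ = 1 := by simp
    rw [norm_div, norm_neg, ht₀n, this, div_one]
  have hslit : ∀ z, -(t z : ℂ) / t₀ ∈ Complex.slitPlane := by
    intro z
    rw [Complex.mem_slitPlane_iff_arg]
    refine ⟨fun h ↦ ht₀ ?_, norm_pos_iff.1 (by rw [hn]; exact one_pos)⟩
    have h1 := Complex.norm_mul_exp_arg_mul_I (-(t z : ℂ) / t₀)
    rw [h, hn, Complex.exp_pi_mul_I, Complex.ofReal_one, one_mul, eq_div_iff ht₀0] at h1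
    have h2 : t z = t₀ := Subtype.ext (by linear_combination h1)
    rw [← h2, hγt]
    exact z.2
  refine ⟨⟨fun z ↦ L (Complex.arg (-(t z : ℂ) / t₀)), hL.comp ?_⟩, fun z ↦ ?_⟩
  · refine continuous_iff_continuousAt.2 fun z ↦ ?_
    exact (Complex.continuousAt_arg (hslit z)).comp
      (f := fun z ↦ -(t z : ℂ) / t₀) (by fun_prop)
  · have h1 := Complex.norm_mul_exp_arg_mul_I (-(t z : ℂ) / t₀)
    rw [hn, Complex.ofReal_one, one_mul] at h1
    simp only [ContinuousMap.coe_mk]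
    rw [hLe, ← hγt z]
    congr 2
    refine Subtype.ext ?_
    simp only
    rw [h1]
    field_simp

/-- Every boundary point of a Jordan domain is a limit of points outside the polynomially convex
hull of its closure. -/
theorem IsJordanDomain.frontier_subset_closure_compl_polyHull {G : Set ℂ} (hG : IsJordanDomain G)
    {z₀ : ℂ} (hz₀ : z₀ ∈ G) : frontier G ⊆ closure (polyHull (closure G))ᶜ := by
  classical
  obtain ⟨hGo, hGb, -, γ, hγ, hγG⟩ := hG
  have hX : IsCompact (closure G) := hGb.isCompact_closure
  have hne : (closure G).Nonempty := ⟨z₀, subset_closure hz₀⟩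
  have hK := isCompact_polyHull hX hne
  have hXK := subset_polyHull (closure G)
  set K := polyHull (closure G)
  have hfr : frontier Kᶜ ⊆ frontier G := by
    rw [frontier_compl, hGo.frontier_eq]
    refine fun z hz ↦ ⟨frontier_polyHull_subset hX hne hz, fun hzG ↦ hz.2 ?_⟩
    exact mem_interior.2 ⟨G, subset_closure.trans hXK, hGo, hzG⟩
  intro β hβ
  by_contra hβU
  rw [← hγG] at hβ
  obtain ⟨t₀, rfl⟩ := hβ
  obtain ⟨ℓ, hℓ⟩ := exists_continuous_log_of_subset_range hγ (t₀ := t₀) (F := frontier Kᶜ)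
    (by rwa [hγG]) (fun h ↦ hβU h.1) (z₀ := z₀) (by rw [hγG, hGo.frontier_eq]; exact fun h ↦ h.2 hz₀)
  obtain ⟨g, hg⟩ := ContinuousMap.exists_restrict_eq isClosed_frontier ℓ
  have hgℓ : ∀ z (hz : z ∈ frontier Kᶜ), g z = ℓ ⟨z, hz⟩ := fun z hz ↦
    DFunLike.congr_fun hg ⟨z, hz⟩
  obtain ⟨C, hC⟩ := hK.isBounded.exists_norm_le
  have hC0 : 0 ≤ C := (norm_nonneg _).trans (hC z₀ (hXK (subset_closure hz₀)))
  obtain ⟨z, hz⟩ := exists_eq_zero_of_eq_sub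
    (f := Kᶜ.piecewise (fun z ↦ z - z₀) fun z ↦ Complex.exp (g z)) (z₀ := z₀) (ρ := C + ‖z₀‖ + 1)
    (Continuous.piecewise (fun z hz ↦ by rw [hgℓ z hz, hℓ]) (by fun_prop) (by fun_prop))
    (by positivity) fun z hz ↦ by
      refine piecewise_eq_of_mem _ _ _ fun hzK ↦ ?_
      rw [mem_sphere, dist_eq_norm] at hz
      linarith [hC z hzK, norm_sub_le z z₀]
  by_cases hzK : z ∈ Kᶜ
  · rw [piecewise_eq_of_mem _ _ _ hzK, sub_eq_zero] at hz
    exact hzK (hz ▸ hXK (subset_closure hz₀))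
  · rw [piecewise_eq_of_notMem _ _ _ hzK] at hz
    exact Complex.exp_ne_zero _ hz

end JordanCurve

section Koebe
open Set Topology Metric ComplexConjugate

/-- The disc automorphism exchanging `a` and `0`, up to sign. -/
noncomputable def discAut (a ζ : ℂ) : ℂ := (ζ - a) / (1 - conj a * ζ)

theorem one_sub_conj_mul_ne_zero {a ζ : ℂ} (h : ‖a‖ * ‖ζ‖ < 1) : 1 - conj a * ζ ≠ 0 := by
  intro h0
  have h1 : ‖conj a * ζ‖ = 1 := by rw [← sub_eq_zero.1 h0, norm_one]
  rw [norm_mul, RCLike.norm_conj] at h1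
  linarith

theorem one_sub_conj_mul_self (a : ℂ) : 1 - conj a * a = ((1 - ‖a‖ ^ 2 : ℝ) : ℂ) := by
  rw [mul_comm, Complex.mul_conj, Complex.normSq_eq_norm_sq]
  push_cast
  ring

theorem hasDerivAt_discAut {a ζ : ℂ} (h : ‖a‖ * ‖ζ‖ < 1) :
    HasDerivAt (discAut a) (((1 - ‖a‖ ^ 2 : ℝ) : ℂ) / (1 - conj a * ζ) ^ 2) ζ := by
  have h0 := one_sub_conj_mul_ne_zero h
  have h1 : HasDerivAt (fun ζ ↦ ζ - a) 1 ζ := (hasDerivAt_id ζ).sub_const a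
  have h2 : HasDerivAt (fun ζ ↦ 1 - conj a * ζ) (-(conj a * 1)) ζ :=
    ((hasDerivAt_id ζ).const_mul (conj a)).const_sub 1
  refine (h1.div h2 h0).congr_deriv ?_
  rw [← one_sub_conj_mul_self]
  congr 1
  ring

theorem norm_discAut_lt_one {a ζ : ℂ} (ha : ‖a‖ < 1) (hζ : ‖ζ‖ < 1) : ‖discAut a ζ‖ < 1 := by
  have h0 := one_sub_conj_mul_ne_zero (a := a) (ζ := ζ)
    (mul_lt_one_of_nonneg_of_lt_one_left (norm_nonneg _) ha hζ.le)
  rw [discAut, norm_div, div_lt_one (norm_pos_iff.2 h0)]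
  refine lt_of_pow_lt_pow_left₀ 2 (norm_nonneg _) ?_
  have key : ‖1 - conj a * ζ‖ ^ 2 - ‖ζ - a‖ ^ 2 = (1 - ‖a‖ ^ 2) * (1 - ‖ζ‖ ^ 2) := by
    simp only [← Complex.normSq_eq_norm_sq, Complex.normSq_apply, Complex.sub_re, Complex.sub_im,
      Complex.mul_re, Complex.mul_im, Complex.conj_re, Complex.conj_im, Complex.one_re,
      Complex.one_im]
    ring
  have h1 : 0 < 1 - ‖a‖ ^ 2 := by nlinarith [norm_nonneg a]
  have h2 : 0 < 1 - ‖ζ‖ ^ 2 := by nlinarith [norm_nonneg ζ]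
  nlinarith [mul_pos h1 h2]

theorem injOn_discAut {a : ℂ} (ha : ‖a‖ < 1) : InjOn (discAut a) (ball 0 1) := by
  intro x hx y hy h
  rw [mem_ball_zero_iff] at hx hy
  have hx0 := one_sub_conj_mul_ne_zero (a := a) (ζ := x)
    (mul_lt_one_of_nonneg_of_lt_one_left (norm_nonneg _) ha hx.le)
  have hy0 := one_sub_conj_mul_ne_zero (a := a) (ζ := y)
    (mul_lt_one_of_nonneg_of_lt_one_left (norm_nonneg _) ha hy.le)
  have ha0 := one_sub_conj_mul_ne_zero (a := a) (ζ := a)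
    (mul_lt_one_of_nonneg_of_lt_one_left (norm_nonneg _) ha ha.le)
  rw [discAut, discAut, div_eq_div_iff hx0 hy0] at h
  have h1 : (x - y) * (1 - conj a * a) = 0 := by linear_combination h
  exact sub_eq_zero.1 ((mul_eq_zero.1 h1).resolve_right ha0)

theorem PolyApprox.discAut {V : Set ℂ} {f : ℂ → ℂ} (hf : PolyApprox V f) {a : ℂ} (ha0 : a ≠ 0)
    (ha : ‖a‖ < 1) (hV : ∀ z ∈ V, ‖f z‖ < 1) : PolyApprox V (fun z ↦ discAut a (f z)) := by
  have hpos : 0 < ‖a‖ := norm_pos_iff.2 ha0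
  refine hf.comp_of_differentiableOn (c := 0) (r := 1) (ρ := 1 / ‖a‖) ?_ (fun ζ hζ ↦ ?_)
    fun z hz ↦ by simpa using (hV z hz).le
  · rwa [lt_div_iff₀ hpos, one_mul]
  · rw [mem_ball_zero_iff, lt_div_iff₀ hpos, mul_comm] at hζ
    exact (hasDerivAt_discAut hζ).differentiableAt.differentiableWithinAt

/-- Injective uniform limits of polynomials near `K` mapping into the unit disc and vanishing at
`z₀`. -/
def IsDiscEmbedding (K : Set ℂ) (z₀ : ℂ) (f : ℂ → ℂ) : Prop :=
  f z₀ = 0 ∧ ∃ V, IsOpen V ∧ K ⊆ V ∧ PolyApprox V f ∧ InjOn f V ∧ ∀ z ∈ V, ‖f z‖ < 1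

/-- The Koebe square-root step: an embedding which omits a value `c = f w` of the disc on `K` can
be replaced by one with larger derivative at `z₀`. -/
theorem exists_isDiscEmbedding_norm_deriv {X V : Set ℂ} (hX : IsCompact X) {z₀ w : ℂ}
    (hz₀ : z₀ ∈ X) {f : ℂ → ℂ} (hV : IsOpen V) (hKV : polyHull X ⊆ V) (hf : PolyApprox V f)
    (hinj : InjOn f V) (hf1 : ∀ z ∈ V, ‖f z‖ < 1) (hf0 : f z₀ = 0) (hw : w ∈ V)
    (hwK : w ∉ polyHull X) :
    ∃ g, IsDiscEmbedding (polyHull X) z₀ g ∧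
      ‖deriv g z₀‖ = (1 + ‖f w‖) / (2 * √‖f w‖) * ‖deriv f z₀‖ := by
  have hne : X.Nonempty := ⟨z₀, hz₀⟩
  have hzK : z₀ ∈ polyHull X := subset_polyHull X hz₀
  set c := f w
  have hc1 : ‖c‖ < 1 := hf1 w hw
  have hc0 : c ≠ 0 := fun h ↦ hwK (by
    have := hinj hw (hKV hzK) (h.trans hf0.symm)
    rwa [this])
  have hcpos : 0 < ‖c‖ := norm_pos_iff.2 hc0
  set T : ℂ → ℂ := fun z ↦ discAut c (f z) with hT
  have hTV : PolyApprox V T := hf.discAut hc0 hc1 hf1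
  have hTinj : InjOn T V := fun x hx y hy h ↦ hinj hx hy <|
    injOn_discAut hc1 (by simpa using hf1 x hx) (by simpa using hf1 y hy) h
  have hT0 : ∀ z ∈ polyHull X, T z ≠ 0 := fun z hz h ↦ hwK (by
    have hTw : T w = 0 := by simp [hT, discAut, c]
    rwa [← hTinj (hKV hz) hw (h.trans hTw.symm)])
  obtain ⟨W, hW, hKW, hWb, Q, hQ, hQT⟩ := hTV.hasPolyLog hX hne hV hKV hT0
  set s : ℂ → ℂ := fun z ↦ Complex.exp (1 / 2 * Q z) with hs
  have hsW : PolyApprox W s := (hQ.const_mul (1 / 2)).comp_of_differentiable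
    Complex.differentiable_exp hWb
  have hsT : ∀ z ∈ W, s z ^ 2 = T z := fun z hz ↦ by
    rw [hs]
    simp only
    rw [← Complex.exp_nat_mul, ← hQT z hz]
    congr 1
    push_cast
    ring
  have hs1 : ∀ z ∈ V ∩ W, ‖s z‖ < 1 := fun z hz ↦ by
    have h1 : ‖s z‖ ^ 2 < 1 := by
      rw [← norm_pow, hsT z hz.2]
      exact norm_discAut_lt_one hc1 (hf1 z hz.1)
    nlinarith [norm_nonneg (s z)]
  have hz₀V : z₀ ∈ V ∩ W := ⟨hKV hzK, hKW hzK⟩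
  set a := s z₀
  have ha1 : ‖a‖ < 1 := hs1 z₀ hz₀V
  have ha0 : a ≠ 0 := Complex.exp_ne_zero _
  have ha2 : a ^ 2 = -c := by
    rw [hsT z₀ hz₀V.2, hT]
    simp [hf0, discAut]
  have han : ‖a‖ ^ 2 = ‖c‖ := by rw [← norm_pow, ha2, norm_neg]
  have hVW : IsOpen (V ∩ W) := hV.inter hW
  have hsV : PolyApprox (V ∩ W) s := hsW.mono inter_subset_right
  refine ⟨fun z ↦ discAut a (s z), ⟨by simp [discAut, a], V ∩ W, hVW, subset_inter hKV hKW,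
    hsV.discAut ha0 ha1 hs1, fun x hx y hy h ↦ hTinj hx.1 hy.1 ?_,
    fun z hz ↦ norm_discAut_lt_one ha1 (hs1 z hz)⟩, ?_⟩
  · rw [← hsT x hx.2, ← hsT y hy.2]
    congr 1
    exact injOn_discAut ha1 (by simpa using hs1 x hx) (by simpa using hs1 y hy) h
  have hfd : HasDerivAt f (deriv f z₀) z₀ :=
    ((hf.differentiableOn hV).differentiableAt (hV.mem_nhds hz₀V.1)).hasDerivAt
  have hsd : HasDerivAt s (deriv s z₀) z₀ :=
    ((hsV.differentiableOn hVW).differentiableAt (hVW.mem_nhds hz₀V)).hasDerivAt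
  have hTd : HasDerivAt T (((1 - ‖c‖ ^ 2 : ℝ) : ℂ) * deriv f z₀) z₀ := by
    have h := hasDerivAt_discAut (a := c) (ζ := f z₀) (by rw [hf0]; simp)
    have h1 := h.comp z₀ hfd
    rw [hf0] at h1
    refine h1.congr_deriv ?_
    simp
  have hsq : HasDerivAt T (2 * a * deriv s z₀) z₀ := by
    have h := (hsd.pow 2).congr_of_eventuallyEq (f := fun z ↦ s z ^ 2) (f₁ := T) <| by
      filter_upwards [hW.mem_nhds hz₀V.2] with z hz
      exact (hsT z hz).symm
    simpa using h
  have heq := congrArg norm (hsq.unique hTd)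
  have hgd := (hasDerivAt_discAut (a := a) (ζ := s z₀)
    (mul_lt_one_of_nonneg_of_lt_one_left (norm_nonneg _) ha1 ha1.le)).comp z₀ hsd
  have hgd' : deriv (fun z ↦ discAut a (s z)) z₀ = _ := hgd.deriv
  rw [hgd']
  change ‖_ / (1 - conj a * a) ^ 2 * _‖ = _
  have h1c : 0 < 1 - ‖c‖ := by linarith
  rw [one_sub_conj_mul_self, norm_mul, norm_div, norm_pow, Complex.norm_real, Real.norm_eq_abs, han,
    abs_of_pos h1c]
  have hsqrt : √‖c‖ = ‖a‖ := by rw [← han, Real.sqrt_sq (norm_nonneg a)]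
  rw [hsqrt]
  have hapos : 0 < ‖a‖ := norm_pos_iff.2 ha0
  have h1c2 : 0 ≤ 1 - ‖c‖ ^ 2 := by nlinarith
  rw [norm_mul, norm_mul, norm_mul, Complex.norm_real, Real.norm_eq_abs, abs_of_nonneg h1c2,
    Complex.norm_ofNat] at heq
  field_simp
  linear_combination heq

theorem exists_norm_deriv_le_of_isDiscEmbedding {K : Set ℂ} {z₀ : ℂ} (hz₀ : K ∈ 𝓝 z₀) :
    ∃ M, ∀ f, IsDiscEmbedding K z₀ f → ‖deriv f z₀‖ ≤ M := by
  obtain ⟨r, hr, hrK⟩ := Metric.nhds_basis_ball.mem_iff.1 hz₀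
  refine ⟨1 / r, ?_⟩
  rintro f ⟨hf0, V, hV, hKV, hf, -, hf1⟩
  refine Complex.norm_deriv_le_div_of_mapsTo_ball
    ((hf.differentiableOn hV).mono (hrK.trans hKV)) (fun z hz ↦ ?_) hr
  simpa [hf0] using (hf1 z (hKV (hrK hz))).le

theorem exists_isDiscEmbedding_deriv_ne_zero {K : Set ℂ} (hK : IsCompact K) (z₀ : ℂ) :
    ∃ f, IsDiscEmbedding K z₀ f ∧ deriv f z₀ ≠ 0 := by
  obtain ⟨V, hV, hKV, hVb⟩ := hK.exists_isOpen_isBounded_superset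
  obtain ⟨M, hM, hMV⟩ := (PolyApprox.sub_const V z₀).exists_norm_le hVb
  have hc : ((M + 1 : ℝ) : ℂ)⁻¹ ≠ 0 := inv_ne_zero (by exact_mod_cast (by positivity))
  refine ⟨fun z ↦ ((M + 1 : ℝ) : ℂ)⁻¹ * (z - z₀), ⟨by simp, V, hV, hKV,
    (PolyApprox.sub_const V z₀).const_mul _, fun x _ y _ h ↦ ?_, fun z hz ↦ ?_⟩, ?_⟩
  · simpa using mul_left_cancel₀ hc h
  · rw [norm_mul, norm_inv, Complex.norm_real, Real.norm_eq_abs, abs_of_pos (by positivity),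
      inv_mul_lt_iff₀ (by positivity)]
    linarith [hMV z hz]
  · have h : HasDerivAt (fun z ↦ ((M + 1 : ℝ) : ℂ)⁻¹ * (z - z₀)) (((M + 1 : ℝ) : ℂ)⁻¹ * 1) z₀ :=
      ((hasDerivAt_id z₀).sub_const z₀).const_mul _
    rw [h.deriv, mul_one]
    exact hc

/-- If an injective holomorphic function does not attain small values near the boundary of `G`, its
derivative is bounded below in terms of the inner conformal radius. -/
theorem le_mul_norm_deriv_of_le_on_frontier {G : Set ℂ} (hGo : IsOpen G)
    (hGb : Bornology.IsBounded G) {z₀ : ℂ} (hz₀ : z₀ ∈ G) {R₀ : ℝ} {φ : ℂ → ℂ}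
    (hφ : DifferentiableOn ℂ φ G) (hφm : MapsTo φ G (ball 0 R₀)) (hφ0 : φ z₀ = 0)
    (hφ1 : deriv φ z₀ = 1) {f : ℂ → ℂ} (hfc : ContinuousOn f (closure G))
    (hf : DifferentiableOn ℂ f G) (hinj : InjOn f G) (hf0 : f z₀ = 0) {ρ : ℝ} (hρ : 0 < ρ)
    (hfr : ∀ z ∈ frontier G, ρ ≤ ‖f z‖) : ρ ≤ R₀ * ‖deriv f z₀‖ := by
  have hop := isOpen_image_of_injOn hGo hf hinj
  have hsub : ball 0 ρ ⊆ f '' G := by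
    refine (isConnected_ball hρ).isPreconnected.subset_of_closure_inter_subset hop
      ⟨0, mem_ball_self hρ, z₀, hz₀, hf0⟩ ?_
    rintro c ⟨hc, hcρ⟩
    have hcl : closure (f '' G) ⊆ f '' closure G :=
      closure_minimal (image_mono subset_closure)
        (hGb.isCompact_closure.image_of_continuousOn hfc).isClosed
    obtain ⟨β, hβ, rfl⟩ := hcl hc
    by_contra hβG
    rw [mem_ball_zero_iff] at hcρ
    refine (hfr β ?_).not_gt hcρ
    rw [hGo.frontier_eq]
    exact ⟨hβ, fun h ↦ hβG ⟨β, h, rfl⟩⟩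
  have hl := hinj.leftInvOn_invFunOn
  have hψ := hasDerivAt_invFunOn hGo hf hinj hz₀
  have hne := deriv_ne_zero_of_injOn hGo hf hinj hz₀
  have hmaps : ∀ ζ ∈ ball (0 : ℂ) ρ, Function.invFunOn f G ζ ∈ G := fun ζ hζ ↦
    Function.invFunOn_mem (hsub hζ)
  have hd : DifferentiableOn ℂ (fun ζ ↦ φ (Function.invFunOn f G ζ)) (ball 0 ρ) := by
    intro ζ hζ
    obtain ⟨x, hx, rfl⟩ := hsub hζ
    have h1 := (hasDerivAt_invFunOn hGo hf hinj hx).differentiableAt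
    refine (DifferentiableAt.comp (f x) (g := φ) ?_ h1).differentiableWithinAt
    rw [hl hx]
    exact hφ.differentiableAt (hGo.mem_nhds hx)
  have hψ0 : Function.invFunOn f G 0 = z₀ := by rw [← hf0, hl hz₀]
  have hder : deriv (fun ζ ↦ φ (Function.invFunOn f G ζ)) 0 = (deriv f z₀)⁻¹ := by
    rw [hf0] at hψ
    have h1 : HasDerivAt φ 1 (Function.invFunOn f G 0) := by
      rw [hψ0, ← hφ1]
      exact (hφ.differentiableAt (hGo.mem_nhds hz₀)).hasDerivAt
    rw [← one_mul (deriv f z₀)⁻¹]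
    exact (h1.comp 0 hψ).deriv
  have hS := Complex.norm_deriv_le_div_of_mapsTo_ball hd (R₂ := R₀) (fun ζ hζ ↦ by
    simpa [hψ0, hφ0] using (mem_ball_zero_iff.1 (hφm (hmaps ζ hζ))).le) hρ
  rw [hder, norm_inv, le_div_iff₀ hρ, inv_mul_le_iff₀ (norm_pos_iff.2 hne)] at hS
  linarith

theorem exists_isDiscEmbedding_lt_mul_norm_deriv {G : Set ℂ} (hG : IsJordanDomain G) {z₀ : ℂ}
    (hz₀ : z₀ ∈ G) {R₀ : ℝ} {φ : ℂ → ℂ} (hφ : DifferentiableOn ℂ φ G)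
    (hφm : MapsTo φ G (ball 0 R₀)) (hφ0 : φ z₀ = 0) (hφ1 : deriv φ z₀ = 1) {η : ℝ} (hη0 : 0 < η)
    (hη : η < 1) :
    ∃ f, IsDiscEmbedding (polyHull (closure G)) z₀ f ∧ η < R₀ * ‖deriv f z₀‖ := by
  have hJ := hG.frontier_subset_closure_compl_polyHull hz₀
  obtain ⟨hGo, hGb, -⟩ := hG
  have hX : IsCompact (closure G) := hGb.isCompact_closure
  have hXz : z₀ ∈ closure G := subset_closure hz₀
  have hK := isCompact_polyHull hX ⟨z₀, hXz⟩
  have hXK := subset_polyHull (closure G)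
  have hGK : G ⊆ polyHull (closure G) := subset_closure.trans hXK
  by_contra! hcon
  obtain ⟨ρ, hρη, hρ1⟩ := exists_between hη
  have hρ0 : 0 < ρ := hη0.trans hρη
  have hsq0 : 0 < √ρ := Real.sqrt_pos.2 hρ0
  have hsq1 : √ρ < 1 := by rw [Real.sqrt_lt' one_pos]; simpa using hρ1
  have hsq := Real.sq_sqrt hρ0.le
  set κ := (1 + ρ) / (2 * √ρ) with hκ
  have hκ1 : 1 < κ := by
    rw [hκ, lt_div_iff₀ (by positivity)]
    nlinarith
  have step : ∀ f, IsDiscEmbedding (polyHull (closure G)) z₀ f →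
      ∃ g, IsDiscEmbedding (polyHull (closure G)) z₀ g ∧ κ * ‖deriv f z₀‖ ≤ ‖deriv g z₀‖ := by
    intro f hfe
    obtain ⟨hf0, V, hV, hKV, hf, hinj, hf1⟩ := id hfe
    have hfd := hf.differentiableOn hV
    obtain ⟨w, hw, hwK, hwρ⟩ : ∃ w ∈ V, w ∉ polyHull (closure G) ∧ ‖f w‖ < ρ := by
      by_contra! hno
      have := le_mul_norm_deriv_of_le_on_frontier hGo hGb hz₀ hφ hφm hφ0 hφ1
        (hfd.continuousOn.mono (hXK.trans hKV)) (hfd.mono (hGK.trans hKV))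
        (hinj.mono (hGK.trans hKV)) hf0 hρ0 fun z hz ↦ ?_
      · exact (hρη.trans_le this).not_ge (hcon f hfe)
      · by_contra! hlt
        have hzV : z ∈ V := hKV (hXK (frontier_subset_closure hz))
        have hev : ∀ᶠ y in 𝓝 z, y ∈ V ∧ ‖f y‖ < ρ := (hV.eventually_mem hzV).and <|
          (hfd.differentiableAt (hV.mem_nhds hzV)).continuousAt.norm.eventually (gt_mem_nhds hlt)
        obtain ⟨y, ⟨hyV, hy⟩, hyK⟩ := mem_closure_iff_nhds.1 (hJ hz) _ hev
        exact (hno y hyV hyK).not_gt hy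
    obtain ⟨g, hg, hgd⟩ := exists_isDiscEmbedding_norm_deriv hX hXz hV hKV hf hinj hf1 hf0 hw hwK
    refine ⟨g, hg, ?_⟩
    rw [hgd]
    gcongr
    have hc0 : 0 < ‖f w‖ := norm_pos_iff.2 fun h ↦ hwK <| by
      rw [hinj hw (hKV (hXK hXz)) (h.trans hf0.symm)]
      exact hXK hXz
    have ht0 : 0 < √‖f w‖ := Real.sqrt_pos.2 hc0
    have htρ : √‖f w‖ < √ρ := Real.sqrt_lt_sqrt hc0.le hwρ
    have ht := Real.sq_sqrt hc0.le
    rw [hκ, div_le_div_iff₀ (by positivity) (by positivity)]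
    nlinarith [mul_nonneg (sub_nonneg.2 htρ.le)
      (sub_nonneg.2 (mul_le_one₀ hsq1.le ht0.le (htρ.trans hsq1).le))]
  obtain ⟨f₀, hf₀, hd₀⟩ := exists_isDiscEmbedding_deriv_ne_zero hK z₀
  have iter : ∀ n : ℕ, ∃ f, IsDiscEmbedding (polyHull (closure G)) z₀ f ∧
      κ ^ n * ‖deriv f₀ z₀‖ ≤ ‖deriv f z₀‖ := by
    intro n
    induction n with
    | zero => exact ⟨f₀, hf₀, by simp⟩
    | succ n ih =>
      obtain ⟨f, hf, hfn⟩ := ih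
      obtain ⟨g, hg, hgn⟩ := step f hf
      refine ⟨g, hg, le_trans ?_ hgn⟩
      rw [pow_succ', mul_assoc]
      gcongr
  obtain ⟨M, hM⟩ := exists_norm_deriv_le_of_isDiscEmbedding
    (mem_of_superset (hGo.mem_nhds hz₀) hGK)
  have hpos := norm_pos_iff.2 hd₀
  obtain ⟨n, hn⟩ := pow_unbounded_of_one_lt (M / ‖deriv f₀ z₀‖) hκ1
  obtain ⟨f, hf, hfn⟩ := iter n
  rw [div_lt_iff₀ hpos] at hn
  linarith [hM f hf]

end Koebe

section Extremal
open Set Topology Metric ComplexConjugate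

theorem PolyApprox.exists_norm_deriv_sub_le {V X : Set ℂ} {f : ℂ → ℂ} (hf : PolyApprox V f)
    (hV : IsOpen V) (hX : IsCompact X) (hXV : X ⊆ V) {ε : ℝ} (hε : 0 < ε) :
    ∃ p : Polynomial ℂ, ∀ z ∈ X, ‖p.derivative.eval z - deriv f z‖ ≤ ε := by
  obtain ⟨δ, hδ, hδV⟩ := hX.exists_cthickening_subset_open hV hXV
  obtain ⟨p, hp⟩ := hf (ε * δ) (by positivity)
  refine ⟨p, fun z hz ↦ ?_⟩
  have hsub : closedBall z δ ⊆ V := (closedBall_subset_cthickening hz δ).trans hδV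
  have hfd := hf.differentiableOn hV
  have hd : DiffContOnCl ℂ (fun z ↦ f z - p.eval z) (ball z δ) := by
    refine DifferentiableOn.diffContOnCl ?_
    rw [closure_ball z hδ.ne']
    exact (hfd.mono hsub).sub p.differentiable.differentiableOn
  have h := Complex.norm_deriv_le_of_forall_mem_sphere_norm_le hδ hd
    fun y hy ↦ hp y (hsub (sphere_subset_closedBall hy))
  rw [mul_div_cancel_right₀ _ hδ.ne', deriv_fun_sub
    (hfd.differentiableAt (hV.mem_nhds (hXV hz))) p.differentiableAt, Polynomial.deriv] at h
  rwa [norm_sub_rev]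

theorem integrableOn_norm_polynomial_sq {G : Set ℂ} (hGb : Bornology.IsBounded G)
    (p : Polynomial ℂ) : IntegrableOn (fun z ↦ ‖p.eval z‖ ^ 2) G :=
  ((p.continuous.norm.pow 2).continuousOn.integrableOn_compact
    hGb.isCompact_closure).mono_set subset_closure

theorem norm_sq_le_of_norm_sub_le {a b : ℂ} {τ : ℝ} (hτ : 0 < τ) (h : ‖a - b‖ ≤ τ) :
    ‖a‖ ^ 2 ≤ (1 + τ) * ‖b‖ ^ 2 + (τ ^ 2 + τ) := by
  have h1 : ‖a‖ ≤ ‖b‖ + τ := by linarith [norm_sub_norm_le a b]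
  have h2 : ‖a‖ ^ 2 ≤ (‖b‖ + τ) ^ 2 := by gcongr
  nlinarith [mul_nonneg hτ.le (sq_nonneg (‖b‖ - 1))]

/-- The Dirichlet integrals of normalized polynomials get arbitrarily close to that of the
normalized conformal map. -/
theorem exists_polynomial_integral_le {G : Set ℂ} (hG : IsJordanDomain G) {z₀ : ℂ}
    (hz₀ : z₀ ∈ G) {R₀ : ℝ} (hR₀ : 0 < R₀) {φ : ℂ → ℂ} (hφ : DifferentiableOn ℂ φ G)
    (hφm : MapsTo φ G (ball 0 R₀)) (hφ0 : φ z₀ = 0) (hφ1 : deriv φ z₀ = 1) {ε : ℝ} (hε : 0 < ε) :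
    ∃ P : Polynomial ℂ, P.eval z₀ = 0 ∧ P.derivative.eval z₀ = 1 ∧
      ∫ z in G, ‖P.derivative.eval z‖ ^ 2 ≤ Real.pi * R₀ ^ 2 + ε := by
  have hπ := Real.pi_pos
  have hS : 0 < Real.pi * R₀ ^ 2 + ε := by positivity
  set q := Real.pi * R₀ ^ 2 / (Real.pi * R₀ ^ 2 + ε) with hq
  have hq0 : 0 < q := by positivity
  have hq1 : q < 1 := by rw [hq, div_lt_one hS]; linarith
  obtain ⟨f, hf, hη⟩ := exists_isDiscEmbedding_lt_mul_norm_deriv hG hz₀ hφ hφm hφ0 hφ1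
    (Real.sqrt_pos.2 hq0) (by rw [Real.sqrt_lt' one_pos]; simpa using hq1)
  obtain ⟨hGo, hGb, -⟩ := hG
  obtain ⟨-, V, hV, hKV, hfV, hinj, hf1⟩ := hf
  have hXV : closure G ⊆ V := (subset_polyHull _).trans hKV
  have hGV : G ⊆ V := subset_closure.trans hXV
  have hfd := (hfV.differentiableOn hV).mono hGV
  set d := ‖deriv f z₀‖
  have hd : 0 < d := pos_of_mul_pos_right ((Real.sqrt_nonneg q).trans_lt hη) hR₀.le
  have hlim0 : ((1 + 0) * Real.pi + (0 ^ 2 + 0) * volume.real G) / (d - 0) ^ 2 <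
      Real.pi * R₀ ^ 2 + ε := by
    have h1 : q < (R₀ * d) ^ 2 := by
      rw [← Real.sq_sqrt hq0.le]
      gcongr
    rw [hq, div_lt_iff₀ hS] at h1
    simp only [add_zero, one_mul, ne_eq, OfNat.ofNat_ne_zero, not_false_eq_true, zero_pow, zero_mul,
      sub_zero]
    rw [div_lt_iff₀ (by positivity)]
    have : 0 < R₀ ^ 2 := by positivity
    nlinarith
  have hcont : ContinuousAt (fun τ : ℝ ↦
      ((1 + τ) * Real.pi + (τ ^ 2 + τ) * volume.real G) / (d - τ) ^ 2) 0 :=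
    ContinuousAt.div (by fun_prop) (by fun_prop) (by simpa using hd.ne')
  obtain ⟨τ, ⟨hτS, hτd⟩, hτ⟩ := (((hcont.eventually (gt_mem_nhds hlim0)).and
    (gt_mem_nhds hd)).filter_mono (nhdsWithin_le_nhds (s := Ioi 0))).and
      self_mem_nhdsWithin |>.exists
  obtain ⟨p, hp⟩ := hfV.exists_norm_deriv_sub_le hV hGb.isCompact_closure hXV hτ
  have hpd : d - τ ≤ ‖p.derivative.eval z₀‖ := by
    have h1 := hp z₀ (subset_closure hz₀)
    rw [norm_sub_rev] at h1
    linarith [norm_sub_norm_le (deriv f z₀) (p.derivative.eval z₀)]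
  have hpd0 : 0 < ‖p.derivative.eval z₀‖ := by linarith
  have hvol : volume G ≠ ⊤ := hGb.measure_lt_top.ne
  have himg : f '' G ⊆ ball 0 1 := by
    rintro _ ⟨z, hz, rfl⟩
    simpa using hf1 z (hGV hz)
  have hball : volume (ball (0 : ℂ) 1) ≠ ⊤ := isBounded_ball.measure_lt_top.ne
  have hfin : volume (f '' G) ≠ ⊤ := measure_ne_top_of_subset himg hball
  have hfint := integrableOn_norm_deriv_sq hGo hfd (hinj.mono hGV) hfin
  have hfle : ∫ z in G, ‖deriv f z‖ ^ 2 ≤ Real.pi := by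
    rw [setIntegral_norm_deriv_sq hGo hfd (hinj.mono hGV)]
    refine (measureReal_mono himg hball).trans ?_
    simp [Measure.real, Complex.volume_ball]
  have hconst : IntegrableOn (fun _ : ℂ ↦ τ ^ 2 + τ) G := integrableOn_const hvol
  have hfint' : IntegrableOn (fun z ↦ (1 + τ) * ‖deriv f z‖ ^ 2 + (τ ^ 2 + τ)) G :=
    (hfint.const_mul (1 + τ)).add hconst
  have hple : ∫ z in G, ‖p.derivative.eval z‖ ^ 2 ≤
      (1 + τ) * Real.pi + (τ ^ 2 + τ) * volume.real G := by
    calc ∫ z in G, ‖p.derivative.eval z‖ ^ 2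
        ≤ ∫ z in G, ((1 + τ) * ‖deriv f z‖ ^ 2 + (τ ^ 2 + τ)) :=
          setIntegral_mono_on (integrableOn_norm_polynomial_sq hGb _)
            hfint' hGo.measurableSet fun z hz ↦
              norm_sq_le_of_norm_sub_le hτ (hp z (subset_closure hz))
      _ = (1 + τ) * (∫ z in G, ‖deriv f z‖ ^ 2) + (τ ^ 2 + τ) * volume.real G := by
          rw [integral_add (hfint.const_mul _) hconst, integral_const_mul, setIntegral_const,
            smul_eq_mul, mul_comm (volume.real G)]
      _ ≤ _ := by
          have : (0 : ℝ) < τ := hτ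
          gcongr
  refine ⟨Polynomial.C (p.derivative.eval z₀)⁻¹ * (p - Polynomial.C (p.eval z₀)), by simp, ?_, ?_⟩
  · simp [inv_mul_cancel₀ (norm_pos_iff.1 hpd0)]
  · refine le_trans (le_of_eq ?_) ((?_ : (∫ z in G, ‖p.derivative.eval z‖ ^ 2) /
      ‖p.derivative.eval z₀‖ ^ 2 ≤ _).trans hτS.le)
    · simp only [Polynomial.derivative_mul, Polynomial.derivative_C, zero_mul, zero_add,
        Polynomial.derivative_sub, sub_zero, Polynomial.eval_mul, Polynomial.eval_C, norm_mul,
        norm_inv, mul_pow]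
      rw [integral_const_mul, inv_pow, inv_mul_eq_div]
    · have : 0 < d - τ := by linarith
      have : 0 ≤ ∫ z in G, ‖p.derivative.eval z‖ ^ 2 := integral_nonneg fun _ ↦ by positivity
      gcongr

/-- For polynomials normalized at `z₀`, the squared `L²` distance of the derivatives to `φ'` is the
excess of the Dirichlet integral. -/
theorem integrableOn_and_integral_norm_sub_deriv_sq {G : Set ℂ} (hGo : IsOpen G)
    (hGb : Bornology.IsBounded G) {z₀ : ℂ} (hz₀ : z₀ ∈ G) {R₀ : ℝ} (hR₀ : 0 < R₀) {φ : ℂ → ℂ}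
    (hφ : DifferentiableOn ℂ φ G) (hφbij : BijOn φ G (ball 0 R₀)) (hφ0 : φ z₀ = 0)
    (hφ1 : deriv φ z₀ = 1) {P : Polynomial ℂ} (hP : P.derivative.eval z₀ = 1) :
    IntegrableOn (fun z ↦ ‖P.derivative.eval z - deriv φ z‖ ^ 2) G ∧
    ∫ z in G, ‖P.derivative.eval z - deriv φ z‖ ^ 2 =
      (∫ z in G, ‖P.derivative.eval z‖ ^ 2) - Real.pi * R₀ ^ 2 := by
  have hinj := hφbij.injOn
  have himg := hφbij.image_eq
  have hl := hinj.leftInvOn_invFunOn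
  have hne : ∀ z ∈ G, deriv φ z ≠ 0 := fun z hz ↦ deriv_ne_zero_of_injOn hGo hφ hinj hz
  have hφd := hφ.deriv hGo
  have hfin : volume (φ '' G) ≠ ⊤ := by rw [himg]; exact isBounded_ball.measure_lt_top.ne
  have hφint := integrableOn_norm_deriv_sq hGo hφ hinj hfin
  have hφval : ∫ z in G, ‖deriv φ z‖ ^ 2 = Real.pi * R₀ ^ 2 := by
    rw [setIntegral_norm_deriv_sq hGo hφ hinj, himg, Measure.real, Complex.volume_ball]
    simp [ENNReal.toReal_ofReal hR₀.le, mul_comm]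
  have hPint := integrableOn_norm_polynomial_sq hGb P.derivative
  have hcint : IntegrableOn (fun z ↦ P.derivative.eval z * conj (deriv φ z)) G := by
    refine (hPint.add hφint).mono' (ContinuousOn.aestronglyMeasurable ?_ hGo.measurableSet)
      (ae_of_all _ fun z ↦ ?_)
    · exact P.derivative.continuous.continuousOn.mul
        (Complex.continuous_conj.comp_continuousOn hφd.continuousOn)
    · simp only [norm_mul, RCLike.norm_conj, Pi.add_apply]
      nlinarith [sq_nonneg (‖P.derivative.eval z‖ - ‖deriv φ z‖),
        sq_nonneg ‖P.derivative.eval z‖, sq_nonneg ‖deriv φ z‖]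
  set g : ℂ → ℂ := fun w ↦ P.derivative.eval (Function.invFunOn φ G w) /
    deriv φ (Function.invFunOn φ G w) with hg
  have hgφ : ∀ z ∈ G, ‖deriv φ z‖ ^ 2 • g (φ z) = P.derivative.eval z * conj (deriv φ z) := by
    intro z hz
    have h0 := hne z hz
    rw [hg]
    simp only
    rw [hl hz, Complex.real_smul, Complex.ofReal_pow, ← Complex.mul_conj']
    field_simp
  have hgd : DifferentiableOn ℂ g (ball 0 R₀) := by
    rw [← himg]
    rintro _ ⟨z, hz, rfl⟩
    have h1 := (hasDerivAt_invFunOn hGo hφ hinj hz).differentiableAt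
    refine DifferentiableAt.differentiableWithinAt (DifferentiableAt.div
      (P.derivative.differentiableAt.comp _ h1) (DifferentiableAt.comp (φ z) (g := deriv φ) ?_ h1) ?_)
    · rw [hl hz]
      exact hφd.differentiableAt (hGo.mem_nhds hz)
    · rw [hl hz]
      exact hne z hz
  have hgint : IntegrableOn g (ball 0 R₀) := by
    rw [← himg, integrableOn_image_iff_of_injOn hGo hφ hinj]
    exact hcint.congr_fun (fun z hz ↦ (hgφ z hz).symm) hGo.measurableSet
  have hcval : ∫ z in G, P.derivative.eval z * conj (deriv φ z) = (Real.pi * R₀ ^ 2 : ℝ) := by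
    rw [← setIntegral_congr_fun hGo.measurableSet hgφ, ← setIntegral_image_eq_of_injOn hGo hφ hinj,
      himg, setIntegral_ball_of_differentiableOn hR₀ hgd hgint]
    have : Function.invFunOn φ G 0 = z₀ := by rw [← hφ0, hl hz₀]
    simp [hg, this, hP, hφ1]
  have hid : ∀ z, ‖P.derivative.eval z - deriv φ z‖ ^ 2 = ‖P.derivative.eval z‖ ^ 2 +
      ‖deriv φ z‖ ^ 2 - 2 * RCLike.re (P.derivative.eval z * conj (deriv φ z)) := by
    intro z
    simp only [← Complex.normSq_eq_norm_sq, Complex.normSq_sub]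
    rfl
  simp_rw [hid]
  have hre := hcint.re
  have hadd : IntegrableOn (fun z ↦ ‖P.derivative.eval z‖ ^ 2 + ‖deriv φ z‖ ^ 2) G :=
    hPint.add hφint
  refine ⟨hadd.sub (hre.const_mul 2), ?_⟩
  rw [integral_sub hadd (hre.const_mul 2), integral_add hPint hφint,
    integral_const_mul, integral_re hcint, hcval, hφval]
  simp only [RCLike.re_to_complex, Complex.ofReal_re]
  ring

theorem norm_sq_le_setIntegral {G : Set ℂ} (hGo : IsOpen G) {h : ℂ → ℂ}
    (hh : DifferentiableOn ℂ h G) (hint : IntegrableOn (fun z ↦ ‖h z‖ ^ 2) G) {z : ℂ} {r : ℝ}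
    (hr : 0 < r) (hz : ball z r ⊆ G) :
    Real.pi * r ^ 2 * ‖h z‖ ^ 2 ≤ ∫ w in G, ‖h w‖ ^ 2 := by
  have hi : IntegrableOn (fun w ↦ h w ^ 2) G := by
    refine hint.mono' ((hh.pow 2).continuousOn.aestronglyMeasurable hGo.measurableSet)
      (ae_of_all _ fun w ↦ ?_)
    rw [norm_pow]
  have hm := setIntegral_ball_of_differentiableOn hr ((hh.pow 2).mono hz) (hi.mono_set hz)
  have hm' := congrArg norm hm
  rw [norm_mul, Complex.norm_real, Real.norm_eq_abs, abs_of_pos (by positivity)] at hm'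
  simp only [Pi.pow_apply, norm_pow] at hm'
  rw [← hm']
  refine (norm_integral_le_integral_norm _).trans ?_
  simp_rw [norm_pow]
  exact setIntegral_mono_set hint (ae_of_all _ fun _ ↦ by positivity) hz.eventuallyLE

/-- If the derivatives converge to `0` in `L²` on a connected open set, and the functions converge
to `0` at a point, then both converge to `0` pointwise. -/
theorem tendsto_zero_of_integral_norm_deriv_sq {G : Set ℂ} (hGo : IsOpen G)
    (hGc : IsPreconnected G) {z₀ : ℂ} (hz₀ : z₀ ∈ G) {h : ℕ → ℂ → ℂ}
    (hh : ∀ n, DifferentiableOn ℂ (h n) G)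
    (hint : ∀ᶠ n in atTop, IntegrableOn (fun z ↦ ‖deriv (h n) z‖ ^ 2) G)
    (hlim : Tendsto (fun n ↦ ∫ z in G, ‖deriv (h n) z‖ ^ 2) atTop (𝓝 0))
    (h0 : Tendsto (fun n ↦ h n z₀) atTop (𝓝 0)) {z : ℂ} (hz : z ∈ G) :
    Tendsto (fun n ↦ deriv (h n) z) atTop (𝓝 0) ∧ Tendsto (fun n ↦ h n z) atTop (𝓝 0) := by
  set b : ℝ → ℕ → ℝ := fun r n ↦ √((∫ z in G, ‖deriv (h n) z‖ ^ 2) / (Real.pi * r ^ 2)) with hb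
  have hblim : ∀ r, Tendsto (b r) atTop (𝓝 0) := fun r ↦ by
    simpa using (hlim.div_const (Real.pi * r ^ 2)).sqrt
  have hbd : ∀ r > 0, ∀ᶠ n in atTop, ∀ y, ball y r ⊆ G → ‖deriv (h n) y‖ ≤ b r n := by
    intro r hr
    filter_upwards [hint] with n hn y hy
    refine Real.le_sqrt_of_sq_le ?_
    rw [le_div_iff₀ (by positivity), mul_comm]
    exact norm_sq_le_setIntegral hGo ((hh n).deriv hGo) hn hr hy
  refine ⟨?_, ?_⟩
  · obtain ⟨r, hr, hrG⟩ := Metric.isOpen_iff.1 hGo z hz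
    exact squeeze_zero_norm' ((hbd r hr).mono fun n hn ↦ hn z hrG) (hblim r)
  have key : ∀ x ∈ G, ∃ δ > 0, ball x δ ⊆ G ∧
      ∀ y ∈ ball x δ, Tendsto (fun n ↦ h n y - h n x) atTop (𝓝 0) := by
    intro x hx
    obtain ⟨r, hr, hrG⟩ := Metric.isOpen_iff.1 hGo x hx
    have hsub : ball x (r / 2) ⊆ G := (ball_subset_ball (by linarith)).trans hrG
    refine ⟨r / 2, by positivity, hsub, fun y hy ↦ ?_⟩
    have hlim' : Tendsto (fun n ↦ b (r / 2) n * ‖y - x‖) atTop (𝓝 0) := by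
      simpa using (hblim (r / 2)).mul_const ‖y - x‖
    refine squeeze_zero_norm' ?_ hlim'
    filter_upwards [hbd (r / 2) (by positivity)] with n hn
    refine (convex_ball x (r / 2)).norm_image_sub_le_of_norm_deriv_le (𝕜 := ℂ)
      (fun w hw ↦ (hh n).differentiableAt (hGo.mem_nhds (hsub hw))) (fun w hw ↦ hn w ?_)
      (mem_ball_self (by positivity)) hy
    refine Subset.trans (ball_subset_ball' ?_) hrG
    rw [mem_ball] at hw
    linarith
  have hsubset : G ⊆ {x | x ∈ G ∧ Tendsto (fun n ↦ h n x) atTop (𝓝 0)} := by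
    refine hGc.subset_of_closure_inter_subset ?_ ⟨z₀, hz₀, hz₀, h0⟩ ?_
    · refine isOpen_iff_mem_nhds.2 fun x ⟨hx, hxl⟩ ↦ ?_
      obtain ⟨δ, hδ, hδG, hl⟩ := key x hx
      filter_upwards [ball_mem_nhds x hδ] with y hy
      exact ⟨hδG hy, by simpa using (hl y hy).add hxl⟩
    · rintro x ⟨hxc, hx⟩
      obtain ⟨δ, hδ, -, hl⟩ := key x hx
      obtain ⟨y, ⟨-, hyl⟩, hxy⟩ := Metric.mem_closure_iff.1 hxc δ hδ
      exact ⟨hx, by simpa using hyl.sub (hl y (by rwa [mem_ball, dist_comm]))⟩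
  exact (hsubset hz).2

end Extremal

/-- Pointwise convergence of the Bieberbach polynomials and their derivatives
to the normalized conformal map `φ` and its derivative on `G`. -/
theorem bieberbach_poly_tendsto_conformal_map
    (G : Set ℂ) (hG : IsJordanDomain G) (z₀ : ℂ) (hz₀ : z₀ ∈ G)
    (R₀ : ℝ) (hR₀ : 0 < R₀) (φ : ℂ → ℂ)
    (hφdiff : DifferentiableOn ℂ φ G)
    (hφbij : Set.BijOn φ G (Metric.ball (0 : ℂ) R₀))
    (hφ0 : φ z₀ = 0) (hφ1 : deriv φ z₀ = 1)
    (B : ℕ → Polynomial ℂ) (hB : ∀ n, 1 ≤ n → IsBieberbachPoly G z₀ n (B n)) :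
    ∀ z ∈ G,
      Tendsto (fun n : ℕ => (B n).derivative.eval z) atTop (nhds (deriv φ z)) ∧
      Tendsto (fun n : ℕ => (B n).eval z) atTop (nhds (φ z)) := by
  intro z hz
  obtain ⟨hGo, hGb, hGs, -⟩ := id hG
  have hGc : IsPreconnected G :=
    (IsSimplyConnected.isPathConnected hGs).isConnected.isPreconnected
  have hder : ∀ n, ∀ w ∈ G, deriv (fun z ↦ (B n).eval z - φ z) w =
      (B n).derivative.eval w - deriv φ w := fun n w hw ↦ by
    rw [deriv_fun_sub (B n).differentiableAt (hφdiff.differentiableAt (hGo.mem_nhds hw)),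
      Polynomial.deriv]
  have hL2 := fun n (hn : 1 ≤ n) ↦ integrableOn_and_integral_norm_sub_deriv_sq hGo hGb hz₀ hR₀
    hφdiff hφbij hφ0 hφ1 (hB n hn).2.2.1
  have hcongr : ∀ n, Set.EqOn (fun w ↦ ‖(B n).derivative.eval w - deriv φ w‖ ^ 2)
      (fun w ↦ ‖deriv (fun z ↦ (B n).eval z - φ z) w‖ ^ 2) G := fun n w hw ↦ by
    simp only [hder n w hw]
  have hint : ∀ᶠ n in atTop,
      IntegrableOn (fun w ↦ ‖deriv (fun z ↦ (B n).eval z - φ z) w‖ ^ 2) G := by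
    filter_upwards [eventually_ge_atTop 1] with n hn
    exact (hL2 n hn).1.congr_fun (hcongr n) hGo.measurableSet
  have hlim : Tendsto (fun n ↦ ∫ w in G, ‖deriv (fun z ↦ (B n).eval z - φ z) w‖ ^ 2) atTop
      (nhds 0) := by
    rw [Metric.tendsto_nhds]
    intro ε hε
    obtain ⟨P, hP0, hP1, hP⟩ := exists_polynomial_integral_le hG hz₀ hR₀ hφdiff hφbij.mapsTo hφ0
      hφ1 (half_pos hε)
    filter_upwards [eventually_ge_atTop 1, eventually_ge_atTop P.natDegree] with n hn hnP
    have h1 := (hB n hn).2.2.2 P hnP hP0 hP1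
    rw [Real.dist_0_eq_abs, abs_of_nonneg (integral_nonneg fun _ ↦ by positivity),
      ← setIntegral_congr_fun hGo.measurableSet (hcongr n), (hL2 n hn).2]
    linarith
  have h0 : Tendsto (fun n ↦ (B n).eval z₀ - φ z₀) atTop (nhds 0) := by
    refine tendsto_const_nhds.congr' ?_
    filter_upwards [eventually_ge_atTop 1] with n hn
    rw [(hB n hn).2.1, hφ0, sub_zero]
  obtain ⟨h1, h2⟩ := tendsto_zero_of_integral_norm_deriv_sq hGo hGc hz₀
    (h := fun n z ↦ (B n).eval z - φ z)
    (fun n ↦ (B n).differentiable.differentiableOn.sub hφdiff) hint hlim h0 hz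
  simp only [hder _ z hz] at h1
  exact ⟨tendsto_sub_nhds_zero_iff.1 h1, tendsto_sub_nhds_zero_iff.1 h2⟩
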